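/- arXiv:2501.04023 — 2 statements merged into one kernel-verified Lean document; each statement's English description precedes it below -/
import Mathlib

section
/- Let d ∈ ℕ, U = [0,1]^d, c > 0 and β ∈ (0,1). There exist a constant C₀ > 0 and sequences (c_ℓ)_{ℓ=0}^∞, (C_ℓ)_{ℓ=0}^∞ of positive reals such that the following holds. For every f ∈ B^{β,c}(U), set M := C₀ · ‖f‖_{B^{β,c}(U)}. Then for every ε with 0 < ε < 1, setting ℓ_ε := ⌈−log₂ ε⌉ + 1, every integer N ≥ max{ 1, ⌈ ( (1/c_{ℓ_ε}) · ln( 2^{ℓ_ε} · C_{ℓ_ε} · ‖f‖_{B^{β,c}(U)} ) )^{d/β} ⌉ } satisfies inf_{f_N ∈ Σ_{N,M}} Σ_{ℓ=0}^∞ 2^{−ℓ} · ‖f − f_N‖_{H^ℓ(U)} / (1 + ‖f − f_N‖_{H^ℓ(U)}) ≤ ε. -/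
open MeasureTheory Real
open scoped InnerProductSpace ENNReal NNReal

noncomputable section

/-- Fourier transform with the convention 𝓕g(ξ) = (2π)^{−d/2} ∫ g(x) e^{−i x·ξ} dx. -/
def fourierT {d : ℕ} (g : EuclideanSpace ℝ (Fin d) → ℂ) (ξ : EuclideanSpace ℝ (Fin d)) : ℂ :=
  (((2 * Real.pi) ^ (-(d : ℝ) / 2) : ℝ) : ℂ) *
    ∫ x : EuclideanSpace ℝ (Fin d), g x * Complex.exp (-(Complex.I * (⟪x, ξ⟫_ℝ : ℂ)))

/-- The exponential spectral Barron norm of `f : U → ℝ` (as a function on ℝ^d whose values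
outside `U` are irrelevant), with values in `ℝ≥0∞`; the infimum of the empty set is `⊤`. -/
def expBarronNorm {d : ℕ} (β c : ℝ) (U : Set (EuclideanSpace ℝ (Fin d)))
    (f : EuclideanSpace ℝ (Fin d) → ℝ) : ℝ≥0∞ :=
  sInf {y : ℝ≥0∞ | ∃ fe : EuclideanSpace ℝ (Fin d) → ℝ, Integrable fe ∧ Set.EqOn fe f U ∧
    y = ∫⁻ ξ, ENNReal.ofReal
      (Real.exp (c * ‖ξ‖ ^ β) * ‖fourierT (fun x => (fe x : ℂ)) ξ‖)}

/-- Iterated partial derivatives along a list of coordinate directions. -/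
def pderivSeq {d : ℕ} {F : Type*} [NormedAddCommGroup F] [NormedSpace ℝ F] :
    List (Fin d) → (EuclideanSpace ℝ (Fin d) → F) → EuclideanSpace ℝ (Fin d) → F
  | [], g => g
  | i :: is, g => pderivSeq is fun x => fderiv ℝ g x (EuclideanSpace.single i 1)

/-- The partial derivative ∂^α for a multi-index α ∈ ℕ^d. -/
def pderivMulti {d : ℕ} {F : Type*} [NormedAddCommGroup F] [NormedSpace ℝ F]
    (α : Fin d → ℕ) (g : EuclideanSpace ℝ (Fin d) → F) : EuclideanSpace ℝ (Fin d) → F :=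
  pderivSeq ((List.finRange d).flatMap fun i => List.replicate (α i) i) g

/-- The Sobolev norm ‖g‖_{H^ℓ(U)} = (Σ_{|α| ≤ ℓ} ∫_U |∂^α g|²)^{1/2}. -/
def sobolevOn {d : ℕ} (ℓ : ℕ) (U : Set (EuclideanSpace ℝ (Fin d)))
    (g : EuclideanSpace ℝ (Fin d) → ℂ) : ℝ :=
  Real.sqrt (∑ α : Fin d → Fin (ℓ + 1),
    if (∑ i, (α i : ℕ)) ≤ ℓ then
      ∫ x in U, ‖pderivMulti (fun i => (α i : ℕ)) g x‖ ^ 2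
    else 0)

/-- The class Σ_{N,M} of shallow cosine (complex exponential) networks. -/
def cosineClass (d N : ℕ) (M : ℝ) : Set (EuclideanSpace ℝ (Fin d) → ℂ) :=
  {g | ∃ (a : Fin N → ℂ) (θ : Fin N → EuclideanSpace ℝ (Fin d)),
    (∑ n, ‖a n‖) ≤ M ∧
    g = fun x => ∑ n, a n * Complex.exp (Complex.I * ((2 * Real.pi * ⟪θ n, x⟫_ℝ : ℝ) : ℂ))}

/-- The unit cube [0,1]^d. -/
def unitCube (d : ℕ) : Set (EuclideanSpace ℝ (Fin d)) :=
  {x | ∀ i, x i ∈ Set.Icc (0 : ℝ) 1}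

lemma ae_fderiv_apply_eq_zero {d : ℕ} {s : Set (EuclideanSpace ℝ (Fin d))} (hs : MeasurableSet s)
    {g : EuclideanSpace ℝ (Fin d) → ℂ} (hg : ∀ x ∈ s, g x = 0) (v : EuclideanSpace ℝ (Fin d)) :
    ∀ᵐ x ∂volume.restrict s, fderiv ℝ g x v = 0 := by
  have key : ∀ L : ℂ →L[ℝ] ℝ, ∀ᵐ x ∂volume.restrict s, L (fderiv ℝ g x v) = 0 := by
    intro L
    rcases eq_or_ne v 0 with rfl | hv
    · simp
    set s' := s ∩ {x | DifferentiableAt ℝ g x} with hs'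
    have hms' : MeasurableSet s' := hs.inter (measurableSet_of_differentiableAt ℝ g)
    let f : EuclideanSpace ℝ (Fin d) → EuclideanSpace ℝ (Fin d) := fun x => L (g x) • v
    have hf0 : ApproximatesLinearOn f (0 : EuclideanSpace ℝ (Fin d) →L[ℝ] _) s' 0 := by
      intro x hx y hy
      simp [f, hg x hx.1, hg y hy.1]
    have h1 := hf0.norm_fderiv_sub_le volume hms'
      (fun x => (L.comp (fderiv ℝ g x)).smulRight v) (by
        intro x hx
        have h2 : HasFDerivAt g (fderiv ℝ g x) x := (hx.2 : DifferentiableAt ℝ g x).hasFDerivAt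
        exact ((L.hasFDerivAt.comp x h2).smul_const v).hasFDerivWithinAt)
    rw [ae_restrict_iff' hms'] at h1
    rw [ae_restrict_iff' hs]
    filter_upwards [h1] with x hx hxs
    by_cases hd : DifferentiableAt ℝ g x
    · have h3 := hx ⟨hxs, hd⟩
      have h4 : L.comp (fderiv ℝ g x) = 0 := by simpa [hv] using h3
      simpa using congrArg (fun T => T v) h4
    · simp [fderiv_zero_of_not_differentiableAt hd]
  filter_upwards [key Complex.reCLM, key Complex.imCLM] with x h1 h2
  exact Complex.ext (by simpa using h1) (by simpa using h2)

lemma ae_fderiv_eq_zero_or {d : ℕ} {U : Set (EuclideanSpace ℝ (Fin d))}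
    {g G : EuclideanSpace ℝ (Fin d) → ℂ} (hG : Differentiable ℝ G)
    (hgm : AEMeasurable g (volume.restrict U))
    (h : ∀ᵐ x ∂volume.restrict U, g x = 0 ∨ g x = G x) (v : EuclideanSpace ℝ (Fin d)) :
    ∀ᵐ x ∂volume.restrict U, fderiv ℝ g x v = 0 ∨ fderiv ℝ g x v = fderiv ℝ G x v := by
  obtain ⟨g', hg'm, hgg'⟩ := hgm
  obtain ⟨t, hts, htm, ht0⟩ :=
    exists_measurable_superset_of_null (ae_iff.1 (hgg'.and h))
  have hGm : Measurable G := hG.continuous.measurable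
  have good : ∀ x, x ∉ t → g x = g' x ∧ (g x = 0 ∨ g x = G x) := by
    intro x hx
    by_contra hc
    exact hx (hts hc)
  set s0 := tᶜ ∩ {x | g' x = 0}
  set s1 := tᶜ ∩ {x | g' x = G x}
  have hs0 : MeasurableSet s0 := htm.compl.inter (measurableSet_eq_fun hg'm measurable_const)
  have hs1 : MeasurableSet s1 := htm.compl.inter (measurableSet_eq_fun hg'm hGm)
  have a0 := ae_fderiv_apply_eq_zero hs0 (g := g)
    (fun x hx => (good x hx.1).1.trans hx.2) v
  have a1 := ae_fderiv_apply_eq_zero hs1 (g := fun x => g x - G x)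
    (fun x hx => by rw [(good x hx.1).1, hx.2, sub_self]) v
  rw [ae_restrict_iff' hs0] at a0
  rw [ae_restrict_iff' hs1] at a1
  have hnt : ∀ᵐ x ∂volume.restrict U, x ∉ t := measure_eq_zero_iff_ae_notMem.1 ht0
  filter_upwards [ae_restrict_of_ae a0, ae_restrict_of_ae a1, hnt] with x h0 h1 hx
  obtain ⟨e, hx0 | hx1⟩ := good x hx
  · exact Or.inl (h0 ⟨hx, e.symm.trans hx0⟩)
  · by_cases hd : DifferentiableAt ℝ g x
    · right
      have := h1 ⟨hx, e.symm.trans hx1⟩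
      rw [fderiv_fun_sub hd (hG x)] at this
      simpa [sub_eq_zero] using this
    · left; simp [fderiv_zero_of_not_differentiableAt hd]

lemma ae_pderivSeq_eq_zero_or {d : ℕ} {U : Set (EuclideanSpace ℝ (Fin d))}
    {T : List (Fin d) → EuclideanSpace ℝ (Fin d) → ℂ} (hT : ∀ L, Differentiable ℝ (T L))
    (hT' : ∀ i L x, fderiv ℝ (T L) x (EuclideanSpace.single i 1) = T (i :: L) x)
    (L : List (Fin d)) : ∀ (L₀ : List (Fin d)) (g : EuclideanSpace ℝ (Fin d) → ℂ),
    AEMeasurable g (volume.restrict U) →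
    (∀ᵐ x ∂volume.restrict U, g x = 0 ∨ g x = T L₀ x) →
    ∀ᵐ x ∂volume.restrict U, pderivSeq L g x = 0 ∨ pderivSeq L g x = T (L.reverse ++ L₀) x := by
  induction L with
  | nil => intro L₀ g _ h; simpa [pderivSeq] using h
  | cons i L ih =>
    intro L₀ g hg h
    have := ih (i :: L₀) (fun x => fderiv ℝ g x (EuclideanSpace.single i 1))
      (measurable_fderiv_apply_const ℝ g _).aemeasurable (by
        simpa only [hT'] using ae_fderiv_eq_zero_or (hT L₀) hg h (EuclideanSpace.single i 1))
    simpa [pderivSeq] using this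

open scoped FourierTransform ContDiff SchwartzMap in
lemma integral_fourier_smul_eq_of_integrable {V : Type*} [NormedAddCommGroup V]
    [InnerProductSpace ℝ V] [FiniteDimensional ℝ V] [MeasurableSpace V] [BorelSpace V]
    {f g : V → ℂ} (hf : Integrable f) (hg : Integrable g) :
    ∫ ξ, 𝓕 f ξ * g ξ = ∫ x, f x * 𝓕 g x := by
  simpa using! VectorFourier.integral_fourierIntegral_smul_eq_flip (L := innerₗ V)
    Real.continuous_fourierChar continuous_inner hf hg

open scoped FourierTransform ContDiff SchwartzMap in
/-- Fourier inversion holds almost everywhere without continuity of the function. -/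
lemma ae_eq_fourierInv_fourier {V : Type*} [NormedAddCommGroup V]
    [InnerProductSpace ℝ V] [FiniteDimensional ℝ V] [MeasurableSpace V] [BorelSpace V]
    {f : V → ℂ} (hf : Integrable f) (hf' : Integrable (𝓕 f)) :
    f =ᵐ[volume] 𝓕⁻ (𝓕 f) := by
  have hcont : Continuous (𝓕⁻ (𝓕 f)) := by
    rw [Real.fourierInv_eq_fourier_comp_neg]
    exact VectorFourier.fourierIntegral_continuous Real.continuous_fourierChar
      (by exact continuous_inner) hf'.comp_neg
  refine ae_eq_of_integral_contDiff_smul_eq hf.locallyIntegrable hcont.locallyIntegrable ?_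
  intro g hg hgc
  have hgc' : HasCompactSupport (fun x => (g x : ℂ)) :=
    hgc.comp_left (g := fun y : ℝ => (y : ℂ)) Complex.ofReal_zero
  let G : 𝓢(V, ℂ) := hgc'.toSchwartzMap (Complex.ofRealCLM.contDiff.comp hg)
  have hG : ∀ x, G x = (g x : ℂ) := fun x => rfl
  have hGinv : 𝓕 (𝓕⁻ G) = G := FourierTransform.fourier_fourierInv_eq G
  have h1 : ∫ x, G x * f x = ∫ x, 𝓕⁻ (G : V → ℂ) x * 𝓕 f x := by
    have := integral_fourier_smul_eq_of_integrable (𝓕⁻ G).integrable hf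
    rw [← SchwartzMap.fourier_coe, hGinv] at this
    rw [this, SchwartzMap.fourierInv_coe]
  have h2 : ∫ x, G x * 𝓕⁻ (𝓕 f) x = ∫ x, 𝓕⁻ (G : V → ℂ) x * 𝓕 f x := by
    have := integral_fourier_smul_eq_of_integrable G.integrable hf'.comp_neg
    rw [Real.fourierInv_eq_fourier_comp_neg, ← this,
      ← integral_neg_eq_self (fun x => 𝓕⁻ (G : V → ℂ) x * 𝓕 f x)]
    simp [Real.fourierInv_eq_fourier_neg]
  simp only [hG] at h1 h2
  simpa [Complex.real_smul] using h1.trans h2.symm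

/-- The character `x ↦ e^{2πi p·x}`. -/
def planeWave {d : ℕ} (p x : EuclideanSpace ℝ (Fin d)) : ℂ :=
  Complex.exp (Complex.I * ((2 * Real.pi * ⟪p, x⟫_ℝ : ℝ) : ℂ))

open scoped FourierTransform in
lemma fourierT_eq_fourier {d : ℕ} (g : EuclideanSpace ℝ (Fin d) → ℂ)
    (ξ : EuclideanSpace ℝ (Fin d)) :
    fourierT g ξ = (((2 * π) ^ (-(d : ℝ) / 2) : ℝ) : ℂ) * 𝓕 g ((2 * π)⁻¹ • ξ) := by
  rw [fourierT, Real.fourier_eq']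
  congr 2
  ext x
  rw [smul_eq_mul, mul_comm, inner_smul_right]
  congr 2
  push_cast
  have : (π : ℂ) ≠ 0 := by exact_mod_cast Real.pi_ne_zero
  field_simp

lemma lintegral_comp_smul_eq {d : ℕ} {Φ : EuclideanSpace ℝ (Fin d) → ℝ≥0∞} (hΦ : Measurable Φ)
    {r : ℝ} (hr : 0 < r) :
    ∫⁻ ξ, Φ (r • ξ) = ENNReal.ofReal ((r ^ d)⁻¹) * ∫⁻ v, Φ v := by
  rw [← lintegral_map hΦ (measurable_const_smul r), Measure.map_addHaar_smul _ hr.ne',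
    lintegral_smul_measure, finrank_euclideanSpace_fin, abs_of_pos (by positivity), smul_eq_mul]

open scoped FourierTransform in
lemma lintegral_weighted_fourier_le {d : ℕ} {c β : ℝ} (hc : 0 ≤ c) (hβ : 0 ≤ β)
    {g : EuclideanSpace ℝ (Fin d) → ℂ} (hg : Integrable g) :
    ∫⁻ v, ENNReal.ofReal (Real.exp (c * ‖v‖ ^ β) * ‖𝓕 g v‖) ≤
      ∫⁻ ξ, ENNReal.ofReal (Real.exp (c * ‖ξ‖ ^ β) * ‖fourierT g ξ‖) := by
  have hcont : Continuous (𝓕 g) := VectorFourier.fourierIntegral_continuous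
    Real.continuous_fourierChar (by exact continuous_inner) hg
  have h2π : 1 ≤ 2 * π := by linarith [Real.pi_gt_three]
  have hpos : (0 : ℝ) < 2 * π := by linarith
  set Φ : EuclideanSpace ℝ (Fin d) → ℝ≥0∞ := fun v =>
    ENNReal.ofReal (Real.exp (c * ‖(2 * π) • v‖ ^ β) * ‖fourierT g ((2 * π) • v)‖) with hΦ
  have hft : ∀ v, ‖fourierT g ((2 * π) • v)‖ = (2 * π) ^ (-(d : ℝ) / 2) * ‖𝓕 g v‖ := by
    intro v
    rw [fourierT_eq_fourier, smul_smul, inv_mul_cancel₀ hpos.ne', one_smul, norm_mul,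
      Complex.norm_real, Real.norm_of_nonneg (by positivity)]
  have hΦm : Measurable Φ := by
    simp only [hΦ, hft]
    have : Continuous fun v : EuclideanSpace ℝ (Fin d) => ‖(2 * π) • v‖ ^ β :=
      (by fun_prop : Continuous fun v : EuclideanSpace ℝ (Fin d) => ‖(2 * π) • v‖).rpow_const
        (fun _ => Or.inr hβ)
    exact ENNReal.measurable_ofReal.comp (by fun_prop : Continuous _).measurable
  have h1 : ∫⁻ ξ, ENNReal.ofReal (Real.exp (c * ‖ξ‖ ^ β) * ‖fourierT g ξ‖)
      = ENNReal.ofReal ((2 * π) ^ d) * ∫⁻ v, Φ v := by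
    have := lintegral_comp_smul_eq hΦm (inv_pos.2 hpos)
    rw [inv_pow, inv_inv] at this
    rw [← this]
    simp only [hΦ, smul_smul, mul_inv_cancel₀ hpos.ne', one_smul]
  rw [h1, ← lintegral_const_mul _ hΦm]
  refine lintegral_mono fun v => ?_
  simp only [hΦ, hft]
  rw [← ENNReal.ofReal_mul (by positivity)]
  refine ENNReal.ofReal_le_ofReal ?_
  have e1 : (1 : ℝ) ≤ (2 * π) ^ d * (2 * π) ^ (-(d : ℝ) / 2) := by
    rw [← Real.rpow_natCast, ← Real.rpow_add hpos]
    exact Real.one_le_rpow h2π (by have : (0:ℝ) ≤ d := by positivity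
                                   linarith)
  have e2 : Real.exp (c * ‖v‖ ^ β) ≤ Real.exp (c * ‖(2 * π) • v‖ ^ β) := by
    refine Real.exp_le_exp.2 (mul_le_mul_of_nonneg_left (Real.rpow_le_rpow (norm_nonneg _) ?_ hβ) hc)
    rw [norm_smul, Real.norm_of_nonneg hpos.le]
    exact le_mul_of_one_le_left (norm_nonneg _) h2π
  calc Real.exp (c * ‖v‖ ^ β) * ‖𝓕 g v‖
      ≤ 1 * (Real.exp (c * ‖(2 * π) • v‖ ^ β) * ‖𝓕 g v‖) := by
        rw [one_mul]; gcongr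
    _ ≤ ((2 * π) ^ d * (2 * π) ^ (-(d : ℝ) / 2)) *
          (Real.exp (c * ‖(2 * π) • v‖ ^ β) * ‖𝓕 g v‖) := by gcongr
    _ = _ := by ring

open scoped FourierTransform in
lemma exists_weight_of_extension {d : ℕ} {c β : ℝ} (hc : 0 ≤ c) (hβ : 0 ≤ β)
    {U : Set (EuclideanSpace ℝ (Fin d))} (hU : MeasurableSet U)
    {f fe : EuclideanSpace ℝ (Fin d) → ℝ} (hfe : Integrable fe) (hf : Set.EqOn fe f U) {b : ℝ}
    (hb0 : 0 ≤ b) (hb : ∫⁻ ξ, ENNReal.ofReal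
      (Real.exp (c * ‖ξ‖ ^ β) * ‖fourierT (fun x => (fe x : ℂ)) ξ‖) ≤ ENNReal.ofReal b) :
    ∃ w : EuclideanSpace ℝ (Fin d) → ℂ, Continuous w ∧
      Integrable (fun v => Real.exp (c * ‖v‖ ^ β) * ‖w v‖) ∧
      ∫ v, Real.exp (c * ‖v‖ ^ β) * ‖w v‖ ≤ b ∧
      ∀ᵐ x ∂volume.restrict U, (f x : ℂ) = ∫ v, w v * planeWave v x := by
  have hg : Integrable (fun x => (fe x : ℂ)) := hfe.ofReal
  have hcont : Continuous (𝓕 (fun x => (fe x : ℂ))) := VectorFourier.fourierIntegral_continuous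
    Real.continuous_fourierChar (by exact continuous_inner) hg
  have hle := (lintegral_weighted_fourier_le hc hβ hg).trans hb
  have hrc : Continuous fun v : EuclideanSpace ℝ (Fin d) => ‖v‖ ^ β :=
    continuous_norm.rpow_const (fun _ => Or.inr hβ)
  have hwc : Continuous fun v => Real.exp (c * ‖v‖ ^ β) * ‖𝓕 (fun x => (fe x : ℂ)) v‖ := by
    fun_prop
  have hnn : 0 ≤ᵐ[volume] fun v => Real.exp (c * ‖v‖ ^ β) * ‖𝓕 (fun x => (fe x : ℂ)) v‖ :=
    Filter.Eventually.of_forall fun v => by positivity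
  have hint : Integrable fun v => Real.exp (c * ‖v‖ ^ β) * ‖𝓕 (fun x => (fe x : ℂ)) v‖ :=
    ⟨hwc.aestronglyMeasurable, by
      rw [hasFiniteIntegral_iff_ofReal hnn]
      exact hle.trans_lt ENNReal.ofReal_lt_top⟩
  refine ⟨𝓕 (fun x => (fe x : ℂ)), hcont, hint, ?_, ?_⟩
  · rw [integral_eq_lintegral_of_nonneg_ae hnn hwc.aestronglyMeasurable]
    exact ENNReal.toReal_le_of_le_ofReal hb0 hle
  · have hint' : Integrable (𝓕 (fun x => (fe x : ℂ))) := by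
      refine hint.mono' hcont.aestronglyMeasurable (Filter.Eventually.of_forall fun v => ?_)
      exact le_mul_of_one_le_left (norm_nonneg _) (Real.one_le_exp (by positivity))
    filter_upwards [ae_restrict_of_ae (ae_eq_fourierInv_fourier hg hint'), ae_restrict_mem hU]
      with x hx hxU
    rw [← hf hxU, hx, Real.fourierInv_eq']
    refine integral_congr_ae (Filter.Eventually.of_forall fun v => ?_)
    simp only [planeWave, smul_eq_mul]
    rw [mul_comm, mul_comm Complex.I]

/-- A function of finite exponential Barron norm agrees almost everywhere on `U` with a Fourier
integral whose weighted `L¹` norm is at most twice the Barron norm (also when that norm is `0`). -/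
lemma exists_weight_of_expBarronNorm {d : ℕ} {c β : ℝ} (hc : 0 ≤ c) (hβ : 0 ≤ β)
    {U : Set (EuclideanSpace ℝ (Fin d))} (hU : MeasurableSet U)
    {f : EuclideanSpace ℝ (Fin d) → ℝ} (hf : expBarronNorm β c U f ≠ ⊤) :
    ∃ w : EuclideanSpace ℝ (Fin d) → ℂ, Continuous w ∧
      Integrable (fun v => Real.exp (c * ‖v‖ ^ β) * ‖w v‖) ∧
      ∫ v, Real.exp (c * ‖v‖ ^ β) * ‖w v‖ ≤ 2 * (expBarronNorm β c U f).toReal ∧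
      ∀ᵐ x ∂volume.restrict U, (f x : ℂ) = ∫ v, w v * planeWave v x := by
  have key : ∀ b : ℝ, (expBarronNorm β c U f).toReal < b →
      ∃ w : EuclideanSpace ℝ (Fin d) → ℂ, Continuous w ∧
      Integrable (fun v => Real.exp (c * ‖v‖ ^ β) * ‖w v‖) ∧
      ∫ v, Real.exp (c * ‖v‖ ^ β) * ‖w v‖ ≤ b ∧
      ∀ᵐ x ∂volume.restrict U, (f x : ℂ) = ∫ v, w v * planeWave v x := by
    intro b hb
    have hlt : expBarronNorm β c U f < ENNReal.ofReal b :=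
      (ENNReal.lt_ofReal_iff_toReal_lt hf).2 hb
    obtain ⟨y, ⟨fe, hfe, hfeU, rfl⟩, hy⟩ := sInf_lt_iff.1 hlt
    exact exists_weight_of_extension hc hβ hU hfe hfeU
      (ENNReal.toReal_nonneg.trans hb.le) hy.le
  rcases (ENNReal.toReal_nonneg (a := expBarronNorm β c U f)).eq_or_lt with h0 | hpos
  · refine ⟨0, continuous_zero, by simp, by simp, ?_⟩
    have hall : ∀ n : ℕ, ∀ᵐ x ∂volume.restrict U, ‖(f x : ℂ)‖ ≤ 1 / ((n : ℝ) + 1) := by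
      intro n
      obtain ⟨w, hw, hwi, hwb, hwf⟩ := key (1 / ((n : ℝ) + 1)) (by rw [← h0]; positivity)
      filter_upwards [hwf] with x hx
      rw [hx]
      refine (norm_integral_le_of_norm_le hwi (Filter.Eventually.of_forall fun v => ?_)).trans hwb
      rw [norm_mul, planeWave, mul_comm Complex.I, Complex.norm_exp_ofReal_mul_I, mul_one]
      exact le_mul_of_one_le_left (norm_nonneg _) (Real.one_le_exp (by positivity))
    filter_upwards [ae_all_iff.2 hall] with x hx
    have : ‖(f x : ℂ)‖ ≤ 0 := ge_of_tendsto' tendsto_one_div_add_atTop_nhds_zero_nat hx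
    simpa using this
  · exact key _ (by linarith)

/-- The factor produced by differentiating `planeWave p` along a list of coordinates. -/
def planeSymbol {d : ℕ} (L : List (Fin d)) (p : EuclideanSpace ℝ (Fin d)) : ℂ :=
  (L.map fun i => 2 * π * Complex.I * (p i : ℂ)).prod

lemma norm_planeWave {d : ℕ} (p x : EuclideanSpace ℝ (Fin d)) : ‖planeWave p x‖ = 1 := by
  rw [planeWave, mul_comm Complex.I, Complex.norm_exp_ofReal_mul_I]

lemma continuous_planeWave {d : ℕ} :
    Continuous fun q : EuclideanSpace ℝ (Fin d) × EuclideanSpace ℝ (Fin d) =>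
      planeWave q.1 q.2 := by
  unfold planeWave; fun_prop

lemma continuous_planeSymbol {d : ℕ} (L : List (Fin d)) : Continuous (planeSymbol L) := by
  induction L with
  | nil =>
    have : planeSymbol ([] : List (Fin d)) = fun _ => 1 := by ext p; simp [planeSymbol]
    rw [this]; exact continuous_const
  | cons i L ih =>
    have : planeSymbol (i :: L) = fun p => (2 * π * Complex.I * (p i : ℂ)) * planeSymbol L p := by
      ext p; simp [planeSymbol]
    rw [this]; fun_prop

lemma norm_planeSymbol_le {d : ℕ} (L : List (Fin d)) (p : EuclideanSpace ℝ (Fin d)) :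
    ‖planeSymbol L p‖ ≤ (2 * π * (1 + ‖p‖)) ^ L.length := by
  induction L with
  | nil => simp [planeSymbol]
  | cons i L ih =>
    have : planeSymbol (i :: L) p = (2 * π * Complex.I * (p i : ℂ)) * planeSymbol L p := by
      simp [planeSymbol]
    rw [this, norm_mul, List.length_cons, pow_succ']
    gcongr
    have h1 : ‖p i‖ ≤ ‖p‖ := PiLp.norm_apply_le p i
    simp only [norm_mul, Complex.norm_I, Complex.norm_real, Complex.norm_ofNat,
      Real.norm_of_nonneg Real.pi_pos.le, mul_one]
    gcongr
    linarith

lemma hasFDerivAt_planeWave {d : ℕ} (p x : EuclideanSpace ℝ (Fin d)) :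
    HasFDerivAt (planeWave p)
      ((2 * π * Complex.I * planeWave p x) • (Complex.ofRealCLM.comp (innerSL ℝ p))) x := by
  have h1 : HasFDerivAt (fun x => ((⟪p, x⟫_ℝ : ℝ) : ℂ)) (Complex.ofRealCLM.comp (innerSL ℝ p)) x :=
    (Complex.ofRealCLM.comp (innerSL ℝ p)).hasFDerivAt
  have h2 := (h1.const_mul (Complex.I * (2 * π))).cexp
  have e : planeWave p = fun x => Complex.exp (Complex.I * (2 * π) * ((⟪p, x⟫_ℝ : ℝ) : ℂ)) := by
    ext y; simp [planeWave, mul_assoc]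
  rw [e]
  refine h2.congr_fderiv ?_
  rw [smul_smul]
  congr 1
  ring

lemma norm_planeWave_deriv_le {d : ℕ} (p x : EuclideanSpace ℝ (Fin d)) :
    ‖(2 * π * Complex.I * planeWave p x) • (Complex.ofRealCLM.comp (innerSL ℝ p))‖
      ≤ 2 * π * ‖p‖ := by
  refine ContinuousLinearMap.opNorm_le_bound _ (by positivity) fun y => ?_
  simp only [smul_apply, ContinuousLinearMap.comp_apply, innerSL_apply_apply,
    Complex.ofRealCLM_apply, norm_smul, norm_mul, norm_planeWave, Complex.norm_I,
    Complex.norm_real, Complex.norm_ofNat, Real.norm_of_nonneg Real.pi_pos.le, mul_one]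
  rw [mul_assoc (2 * π)]
  exact mul_le_mul_of_nonneg_left (norm_inner_le_norm _ _) (by positivity)

lemma hasFDerivAt_integral_planeWave {d : ℕ} {u : EuclideanSpace ℝ (Fin d) → ℂ}
    (hu : Continuous u) (hui : Integrable u) (hui' : Integrable fun v => ‖v‖ * ‖u v‖)
    (x : EuclideanSpace ℝ (Fin d)) :
    HasFDerivAt (fun x => ∫ v, u v * planeWave v x)
      (∫ v, u v • ((2 * π * Complex.I * planeWave v x) •
        (Complex.ofRealCLM.comp (innerSL ℝ v)))) x := by
  have hpw : ∀ x : EuclideanSpace ℝ (Fin d), Continuous fun v => planeWave v x := fun x =>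
    continuous_planeWave.comp (by fun_prop : Continuous fun v => (v, x))
  refine hasFDerivAt_integral_of_dominated_of_fderiv_le (𝕜 := ℝ)
    (F := fun x v => u v * planeWave v x)
    (F' := fun x v => u v • ((2 * π * Complex.I * planeWave v x) •
      (Complex.ofRealCLM.comp (innerSL ℝ v)))) (s := Set.univ)
    (bound := fun v => 2 * π * (‖v‖ * ‖u v‖)) Filter.univ_mem ?_ ?_ ?_ ?_ (hui'.const_mul _) ?_
  · exact Filter.Eventually.of_forall fun x => (hu.mul (hpw x)).aestronglyMeasurable
  · exact hui.mono (hu.mul (hpw x)).aestronglyMeasurable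
      (Filter.Eventually.of_forall fun v => by simp [norm_planeWave])
  · refine Continuous.aestronglyMeasurable ?_
    have h1 := hpw x
    have h2 : Continuous fun v : EuclideanSpace ℝ (Fin d) =>
        Complex.ofRealCLM.comp (innerSL ℝ v) := by fun_prop
    fun_prop
  · refine Filter.Eventually.of_forall fun v x _ => ?_
    rw [norm_smul]
    calc _ ≤ ‖u v‖ * (2 * π * ‖v‖) := by gcongr; exact norm_planeWave_deriv_le v x
      _ = _ := by ring
  · exact Filter.Eventually.of_forall fun v x _ => (hasFDerivAt_planeWave v x).const_mul (u v)

/-- The derivative along `L` of a Fourier integral minus a finite exponential sum. -/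
def errorTower {d : ℕ} {ι : Type*} [Fintype ι] (w : EuclideanSpace ℝ (Fin d) → ℂ) (a : ι → ℂ)
    (p : ι → EuclideanSpace ℝ (Fin d)) (L : List (Fin d)) (x : EuclideanSpace ℝ (Fin d)) : ℂ :=
  (∫ v, w v * planeSymbol L v * planeWave v x) -
    ∑ k, a k * planeSymbol L (p k) * planeWave (p k) x

lemma integrable_pow_mul_symbol {d : ℕ} {w : EuclideanSpace ℝ (Fin d) → ℂ} (hw : Continuous w)
    (hwi : ∀ m : ℕ, Integrable fun v => (1 + ‖v‖) ^ m * ‖w v‖) (L : List (Fin d)) :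
    Integrable fun v => (1 + ‖v‖) * ‖w v * planeSymbol L v‖ := by
  have hs := continuous_planeSymbol L
  refine ((hwi (L.length + 1)).const_mul ((2 * π) ^ L.length)).mono'
    (by fun_prop : Continuous _).aestronglyMeasurable (Filter.Eventually.of_forall fun v => ?_)
  rw [Real.norm_of_nonneg (by positivity), norm_mul]
  calc (1 + ‖v‖) * (‖w v‖ * ‖planeSymbol L v‖)
      ≤ (1 + ‖v‖) * (‖w v‖ * (2 * π * (1 + ‖v‖)) ^ L.length) := by
        gcongr; exact norm_planeSymbol_le L v
    _ = _ := by rw [mul_pow]; ring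

lemma hasFDerivAt_errorTower {d : ℕ} {ι : Type*} [Fintype ι] {w : EuclideanSpace ℝ (Fin d) → ℂ}
    (hw : Continuous w) (hwi : ∀ m : ℕ, Integrable fun v => (1 + ‖v‖) ^ m * ‖w v‖) (a : ι → ℂ)
    (p : ι → EuclideanSpace ℝ (Fin d)) (L : List (Fin d)) (x : EuclideanSpace ℝ (Fin d)) :
    ∃ D : EuclideanSpace ℝ (Fin d) →L[ℝ] ℂ, HasFDerivAt (errorTower w a p L) D x ∧
      ∀ i, D (EuclideanSpace.single i 1) = errorTower w a p (i :: L) x := by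
  have hs := continuous_planeSymbol L
  have h0 := integrable_pow_mul_symbol hw hwi L
  have hc : Continuous fun v => w v * planeSymbol L v := hw.mul hs
  have hui : Integrable fun v => w v * planeSymbol L v :=
    h0.mono' hc.aestronglyMeasurable (Filter.Eventually.of_forall fun v =>
      le_mul_of_one_le_left (norm_nonneg _) (by linarith [norm_nonneg v]))
  have hui' : Integrable fun v => ‖v‖ * ‖w v * planeSymbol L v‖ :=
    h0.mono' (by fun_prop : Continuous _).aestronglyMeasurable
      (Filter.Eventually.of_forall fun v => by
        rw [Real.norm_of_nonneg (by positivity)]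
        gcongr; linarith [norm_nonneg v])
  refine ⟨_, (hasFDerivAt_integral_planeWave hc hui hui' x).sub
    (HasFDerivAt.fun_sum fun k (_ : k ∈ Finset.univ) =>
      (hasFDerivAt_planeWave (p k) x).const_mul (a k * planeSymbol L (p k))), fun i => ?_⟩
  have hin : ∀ v : EuclideanSpace ℝ (Fin d), ⟪v, EuclideanSpace.single i (1 : ℝ)⟫_ℝ = v i := by
    intro v; simp [EuclideanSpace.inner_single_right]
  have hpw : Continuous fun v => planeWave v x :=
    continuous_planeWave.comp (by fun_prop : Continuous fun v => (v, x))
  rw [sub_apply, ContinuousLinearMap.integral_apply]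
  · simp only [errorTower, sum_apply, smul_apply,
      ContinuousLinearMap.comp_apply, innerSL_apply_apply, Complex.ofRealCLM_apply, hin,
      planeSymbol, List.map_cons, List.prod_cons, smul_eq_mul]
    congr 1
    · congr 1; ext v; ring
    · exact Finset.sum_congr rfl fun k _ => by ring
  · have h2 : Continuous fun v : EuclideanSpace ℝ (Fin d) =>
        Complex.ofRealCLM.comp (innerSL ℝ v) := by fun_prop
    refine (hui'.const_mul (2 * π)).mono' (Continuous.aestronglyMeasurable (by fun_prop))
      (Filter.Eventually.of_forall fun v => ?_)
    rw [norm_smul]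
    calc _ ≤ ‖w v * planeSymbol L v‖ * (2 * π * ‖v‖) := by
          gcongr; exact norm_planeWave_deriv_le v x
      _ = _ := by ring

open scoped FourierTransform ContDiff SchwartzMap in
lemma exists_schwartz_local_exponential {χ : ℝ → ℂ} (hχ : ContDiff ℝ ∞ χ)
    (hχ1 : ∀ t, |t| < 3 / 8 → χ t = 1) (hχ0 : ∀ t, 7 / 16 < |t| → χ t = 0) (η : ℝ) (m : ℕ) :
    ∃ F : 𝓢(ℝ, ℂ),
      (∀ t : ℝ, |t| < 3 / 8 →
        F t = (2 * π * Complex.I * η) ^ m * Complex.exp (2 * π * Complex.I * η * t)) ∧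
      (∀ t : ℝ, 7 / 16 < |t| → F t = 0) ∧
      ∀ x : ℝ, 𝓕 F x = (2 * π * Complex.I * x) ^ m * 𝓕 χ (x - η) := by
  induction m with
  | zero =>
    have hsupp : HasCompactSupport fun t : ℝ => χ t * Complex.exp (2 * π * Complex.I * η * t) := by
      refine HasCompactSupport.intro (isCompact_Icc (a := -(7 / 16 : ℝ)) (b := 7 / 16)) ?_
      intro t ht
      rw [hχ0 t, zero_mul]
      by_contra hc
      exact ht (abs_le.1 (not_lt.1 hc))
    have hsm : ContDiff ℝ ∞ fun t : ℝ => χ t * Complex.exp (2 * π * Complex.I * η * t) := by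
      have : ContDiff ℝ ∞ fun t : ℝ => (t : ℂ) := Complex.ofRealCLM.contDiff
      fun_prop
    refine ⟨hsupp.toSchwartzMap hsm, fun t ht => ?_, fun t ht => ?_, fun x => ?_⟩
    · simp [hχ1 t ht]
    · simp [hχ0 t ht]
    · rw [SchwartzMap.fourier_coe, pow_zero, one_mul, Real.fourier_real_eq_integral_exp_smul,
        Real.fourier_real_eq_integral_exp_smul]
      congr 1
      ext t
      simp only [HasCompactSupport.toSchwartzMap_toFun, smul_eq_mul]
      rw [mul_left_comm, mul_comm, ← Complex.exp_add]
      congr 2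
      push_cast
      ring
  | succ m ih =>
    obtain ⟨F, h1, h0, hF⟩ := ih
    refine ⟨SchwartzMap.derivCLM ℝ ℂ F, fun t ht => ?_, fun t ht => ?_, fun x => ?_⟩
    · rw [SchwartzMap.derivCLM_apply]
      have hev : (F : ℝ → ℂ) =ᶠ[nhds t] fun t : ℝ =>
          (2 * π * Complex.I * η) ^ m * Complex.exp (2 * π * Complex.I * η * t) := by
        filter_upwards [(isOpen_lt continuous_abs continuous_const).mem_nhds ht] with y hy
        exact h1 y hy
      rw [hev.deriv_eq]
      have hd : HasDerivAt (fun t : ℝ => (t : ℂ)) 1 t := Complex.ofRealCLM.hasDerivAt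
      have := ((hd.const_mul (2 * π * Complex.I * η)).cexp.const_mul
        ((2 * π * Complex.I * η) ^ m)).deriv
      rw [this, pow_succ]
      ring
    · rw [SchwartzMap.derivCLM_apply]
      have hev : (F : ℝ → ℂ) =ᶠ[nhds t] fun _ : ℝ => 0 := by
        filter_upwards [(isOpen_lt continuous_const continuous_abs).mem_nhds ht] with y hy
        exact h0 y hy
      rw [hev.deriv_eq, deriv_const]
    · have := Real.fourier_deriv F.integrable F.differentiable
        (SchwartzMap.derivCLM ℝ ℂ F).integrable
      rw [SchwartzMap.fourier_coe]
      have e : (SchwartzMap.derivCLM ℝ ℂ F : ℝ → ℂ) = deriv F := by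
        ext y; exact SchwartzMap.derivCLM_apply ..
      rw [e, this]
      beta_reduce
      rw [smul_eq_mul, ← SchwartzMap.fourier_coe, hF, pow_succ]
      ring

open scoped FourierTransform ContDiff SchwartzMap in
/-- A rapidly decaying kernel that reproduces exponentials on `[0, 1/4]` from their samples. -/
lemma exists_reproducing_kernel :
    ∃ h : ℝ → ℂ, Continuous h ∧ (∀ m : ℕ, ∃ D : ℝ, ∀ ζ, (1 + |ζ|) ^ m * ‖h ζ‖ ≤ D) ∧
      ∀ (η : ℝ) (m : ℕ), ∀ t ∈ Set.Icc (0 : ℝ) (1 / 4),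
        HasSum (fun k : ℤ => h (η - k) * (2 * π * Complex.I * k) ^ m *
          Complex.exp (2 * π * Complex.I * k * t))
          ((2 * π * Complex.I * η) ^ m * Complex.exp (2 * π * Complex.I * η * t)) := by
  let χb : ContDiffBump (0 : ℝ) := ⟨3 / 8, 7 / 16, by norm_num, by norm_num⟩
  let χ : ℝ → ℂ := fun t => (χb t : ℂ)
  have hχ : ContDiff ℝ ∞ χ := Complex.ofRealCLM.contDiff.comp χb.contDiff
  have hχ1 : ∀ t, |t| < 3 / 8 → χ t = 1 := by
    intro t ht
    have := χb.one_of_mem_closedBall (x := t) (by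
      simpa [Metric.mem_closedBall, Real.dist_eq] using ht.le)
    simp [χ, this]
  have hχ0 : ∀ t, 7 / 16 < |t| → χ t = 0 := by
    intro t ht
    have := χb.zero_of_le_dist (x := t) (by simpa [Real.dist_eq] using ht.le)
    simp [χ, this]
  obtain ⟨X, hX1, hX0, hX⟩ := exists_schwartz_local_exponential hχ hχ1 hχ0 0 0
  have hXF : ∀ x, 𝓕 X x = 𝓕 χ x := fun x => by simpa using hX x
  refine ⟨fun ζ => 𝓕 X (-ζ), by have := (𝓕 X).continuous; fun_prop, fun m => ?_,
    fun η m t ht => ?_⟩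
  · refine ⟨2 ^ m * (Finset.Iic (m, 0)).sup (fun p => SchwartzMap.seminorm ℝ p.1 p.2) (𝓕 X),
      fun ζ => ?_⟩
    simpa using SchwartzMap.one_add_le_sup_seminorm_apply (𝕜 := ℝ) (m := (m, 0)) le_rfl le_rfl
      (𝓕 X) (-ζ)
  · obtain ⟨F, h1, h0, hF⟩ := exists_schwartz_local_exponential hχ hχ1 hχ0 η m
    have hsum : Summable fun k : ℤ => 𝓕 F k * fourier k (t : UnitAddCircle) := by
      have hs : Summable fun k : ℤ => 𝓕 F (k : ℝ) :=
        summable_of_isBigO (Real.summable_abs_int_rpow one_lt_two)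
          (((𝓕 F).isBigO_cocompact_rpow (-2)).comp_tendsto Int.tendsto_coe_cofinite)
      refine Summable.of_norm_bounded hs.norm fun k => ?_
      rw [norm_mul, fourier_coe_apply]
      refine mul_le_of_le_one_right (norm_nonneg _) (le_of_eq ?_)
      rw [show 2 * (π : ℂ) * Complex.I * k * t / (1 : ℝ) = ((2 * π * k * t : ℝ) : ℂ) * Complex.I by
        push_cast; ring]
      exact Complex.norm_exp_ofReal_mul_I _
    have hval : ∑' n : ℤ, F (t + n) =
        (2 * π * Complex.I * η) ^ m * Complex.exp (2 * π * Complex.I * η * t) := by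
      rw [tsum_eq_single 0]
      · rw [Int.cast_zero, add_zero]
        exact h1 t (by rw [abs_of_nonneg ht.1]; linarith [ht.2])
      · intro n hn
        apply h0
        rcases lt_or_gt_of_ne hn with hlt | hgt
        · have : (n : ℝ) ≤ -1 := by exact_mod_cast Int.le_sub_one_of_lt hlt
          rw [abs_of_nonpos (by linarith [ht.2])]
          linarith [ht.2]
        · have : (1 : ℝ) ≤ n := by exact_mod_cast hgt
          rw [abs_of_nonneg (by linarith [ht.1])]
          linarith [ht.1]
    have := hsum.hasSum
    rw [← SchwartzMap.tsum_eq_tsum_fourier, hval] at this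
    convert this using 1
    ext k
    have hk : (𝓕 X) (-(η - k)) = 𝓕 χ (k - η) := by rw [hXF, neg_sub]
    beta_reduce
    rw [hk, hF, fourier_coe_apply]
    push_cast
    rw [div_one]
    ring

lemma exists_tsum_shift_inv_sq_le :
    ∃ C : ℝ, 0 < C ∧ ∀ η : ℝ, Summable (fun k : ℤ => ((1 + |η - k|) ^ 2)⁻¹) ∧
      ∑' k : ℤ, ((1 + |η - k|) ^ 2)⁻¹ ≤ C := by
  have hs : Summable fun l : ℤ => 4 * ((1 + |(l : ℝ)|) ^ 2)⁻¹ := by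
    have h2 : Summable fun l : ℤ => 16 * |(l : ℝ) + 1 / 2| ^ (-2 : ℝ) := by
      have := (Real.summable_one_div_int_add_rpow (1 / 2) 2).2 one_lt_two
      refine (this.mul_left 16).congr fun l => ?_
      rw [Real.rpow_neg (abs_nonneg _), one_div]
    refine Summable.of_nonneg_of_le (fun l => by positivity) (fun l => ?_) h2
    have hpos : 0 < |(l : ℝ) + 1 / 2| := by
      rw [abs_pos]
      intro h
      have : (2 * l + 1 : ℤ) = 0 := by
        have : ((2 * l + 1 : ℤ) : ℝ) = 0 := by push_cast; linarith
        exact_mod_cast this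
      omega
    have hle : |(l : ℝ) + 1 / 2| ≤ 2 * (1 + |(l : ℝ)|) := by
      have := abs_add_le (l : ℝ) (1 / 2)
      rw [abs_of_pos (by norm_num : (0 : ℝ) < 1 / 2)] at this
      linarith [abs_nonneg (l : ℝ)]
    rw [Real.rpow_neg (abs_nonneg _), Real.rpow_two]
    have : ((2 * (1 + |(l : ℝ)|)) ^ 2)⁻¹ ≤ (|(l : ℝ) + 1 / 2| ^ 2)⁻¹ := by gcongr
    rw [mul_pow, mul_inv] at this
    linarith
  have key : ∀ η : ℝ, Summable (fun k : ℤ => ((1 + |η - k|) ^ 2)⁻¹) ∧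
      ∑' k : ℤ, ((1 + |η - k|) ^ 2)⁻¹ ≤ ∑' l : ℤ, 4 * ((1 + |(l : ℝ)|) ^ 2)⁻¹ := by
    intro η
    have hle : ∀ l : ℤ, ((1 + |η - ((l + ⌊η⌋ : ℤ) : ℝ)|) ^ 2)⁻¹ ≤ 4 * ((1 + |(l : ℝ)|) ^ 2)⁻¹ := by
      intro l
      have h0 := Int.fract_nonneg η
      have h1 := Int.fract_lt_one η
      have e : η - ((l + ⌊η⌋ : ℤ) : ℝ) = Int.fract η - l := by
        rw [Int.fract]; push_cast; ring
      rw [e]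
      have : 1 + |(l : ℝ)| ≤ 2 * (1 + |Int.fract η - l|) := by
        have := abs_sub_abs_le_abs_sub (l : ℝ) (Int.fract η)
        rw [abs_sub_comm, abs_of_nonneg h0] at this
        linarith [abs_nonneg (Int.fract η - l)]
      have : ((2 * (1 + |Int.fract η - l|)) ^ 2)⁻¹ ≤ ((1 + |(l : ℝ)|) ^ 2)⁻¹ := by gcongr
      rw [mul_pow, mul_inv] at this
      linarith
    have hsum : Summable fun l : ℤ => ((1 + |η - ((l + ⌊η⌋ : ℤ) : ℝ)|) ^ 2)⁻¹ :=
      Summable.of_nonneg_of_le (fun l => by positivity) hle hs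
    refine ⟨(Equiv.addRight ⌊η⌋).summable_iff.1 hsum, ?_⟩
    rw [← (Equiv.addRight ⌊η⌋).tsum_eq]
    exact hsum.tsum_le_tsum hle hs
  exact ⟨(∑' l : ℤ, 4 * ((1 + |(l : ℝ)|) ^ 2)⁻¹) + 1,
    add_pos_of_nonneg_of_pos (tsum_nonneg fun l => by positivity) one_pos,
    fun η => ⟨(key η).1, (key η).2.trans (by linarith)⟩⟩

/-- The average of `u ↦ exp (-2πi s u ζ)` over `[0, 1]`. -/
def windowSymbol (s ζ : ℝ) : ℂ := ∫ u in (0 : ℝ)..1, Complex.exp (-(2 * π * Complex.I * s * u * ζ))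

lemma norm_exp_window (s u ζ : ℝ) : ‖Complex.exp (-(2 * π * Complex.I * s * u * ζ))‖ = 1 := by
  rw [show -(2 * (π : ℂ) * Complex.I * s * u * ζ) = ((-(2 * π * s * u * ζ) : ℝ) : ℂ) * Complex.I by
    push_cast; ring]
  exact Complex.norm_exp_ofReal_mul_I _

lemma continuous_windowSymbol (s : ℝ) : Continuous (windowSymbol s) := by
  unfold windowSymbol
  refine intervalIntegral.continuous_parametric_intervalIntegral_of_continuous'
    (f := fun ζ u : ℝ => Complex.exp (-(2 * π * Complex.I * s * u * ζ))) ?_ 0 1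
  fun_prop

lemma norm_windowSymbol_le_one (s ζ : ℝ) : ‖windowSymbol s ζ‖ ≤ 1 := by
  have := intervalIntegral.norm_integral_le_of_norm_le_const (a := 0) (b := 1) (C := 1)
    (f := fun u : ℝ => Complex.exp (-(2 * π * Complex.I * s * u * ζ)))
    fun u _ => (norm_exp_window s u ζ).le
  simpa [windowSymbol] using this

lemma norm_windowSymbol_le {s ζ : ℝ} (hs : 0 < s) (hζ : ζ ≠ 0) :
    ‖windowSymbol s ζ‖ ≤ 1 / (π * s * |ζ|) := by
  have hc : -(2 * (π : ℂ) * Complex.I * s * ζ) ≠ 0 := by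
    simp [hζ, hs.ne', Real.pi_ne_zero]
  have e : windowSymbol s ζ = (Complex.exp (-(2 * π * Complex.I * s * (1 : ℝ) * ζ)) -
      Complex.exp (-(2 * π * Complex.I * s * (0 : ℝ) * ζ))) / -(2 * (π : ℂ) * Complex.I * s * ζ) := by
    have := integral_exp_mul_complex (a := 0) (b := 1) hc
    unfold windowSymbol
    convert this using 3 <;> (congr 1; ring)
  rw [e, norm_div]
  have h2 := norm_sub_le (Complex.exp (-(2 * π * Complex.I * s * (1 : ℝ) * ζ)))
    (Complex.exp (-(2 * π * Complex.I * s * (0 : ℝ) * ζ)))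
  rw [norm_exp_window, norm_exp_window] at h2
  have hn : ‖-(2 * (π : ℂ) * Complex.I * s * ζ)‖ = 2 * (π * s * |ζ|) := by
    simp [abs_of_pos hs, abs_of_pos Real.pi_pos]
    ring
  rw [hn]
  have hpos : 0 < π * s * |ζ| := by positivity
  rw [div_le_div_iff₀ (by positivity) hpos]
  nlinarith

lemma hasSum_windowSymbol_mul {b : ℤ → ℂ} {A : ℂ} {η a s : ℝ} (hs : 0 ≤ s)
    (hb : Summable fun k => ‖b k‖)
    (h : ∀ t ∈ Set.Icc 0 (a + s), HasSum (fun k : ℤ => b k * Complex.exp (2 * π * Complex.I * k * t))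
      (A * Complex.exp (2 * π * Complex.I * η * t))) :
    ∀ t ∈ Set.Icc 0 a,
      HasSum (fun k : ℤ => windowSymbol s (η - k) * b k * Complex.exp (2 * π * Complex.I * k * t))
        (A * Complex.exp (2 * π * Complex.I * η * t)) := by
  intro t ht
  have hnorm : ∀ (k : ℤ) (u : ℝ), ‖b k * Complex.exp (2 * π * Complex.I * k * t) *
      Complex.exp (-(2 * π * Complex.I * s * u * (η - k : ℝ)))‖ = ‖b k‖ := by
    intro k u
    rw [norm_mul, norm_mul, norm_exp_window, mul_one,
      show 2 * (π : ℂ) * Complex.I * k * t = ((2 * π * k * t : ℝ) : ℂ) * Complex.I by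
        push_cast; ring, Complex.norm_exp_ofReal_mul_I, mul_one]
  have := intervalIntegral.hasSum_integral_of_dominated_convergence (ι := ℤ) (μ := volume)
    (a := 0) (b := 1)
    (F := fun k u => b k * Complex.exp (2 * π * Complex.I * k * t) *
      Complex.exp (-(2 * π * Complex.I * s * u * (η - k : ℝ))))
    (f := fun _ => A * Complex.exp (2 * π * Complex.I * η * t))
    (fun k _ => ‖b k‖) (fun k => by
      have : Continuous fun u : ℝ => b k * Complex.exp (2 * π * Complex.I * k * t) *
        Complex.exp (-(2 * π * Complex.I * s * u * (η - k : ℝ))) := by fun_prop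
      exact this.aestronglyMeasurable)
    (fun k => .of_forall fun u _ => (hnorm k u).le) (.of_forall fun u _ => hb)
    (by simp) (.of_forall fun u hu => ?_)
  · rw [intervalIntegral.integral_const, sub_zero, one_smul] at this
    have e : ∀ k : ℤ, windowSymbol s (η - k) * b k * Complex.exp (2 * π * Complex.I * k * t) =
        ∫ u in (0 : ℝ)..1, b k * Complex.exp (2 * π * Complex.I * k * t) *
          Complex.exp (-(2 * π * Complex.I * s * u * (η - k : ℝ))) := by
      intro k
      rw [intervalIntegral.integral_const_mul, windowSymbol]
      ring
    simp only [e]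
    exact this
  · rw [Set.uIoc_of_le zero_le_one] at hu
    have h1 := (h (t + s * u) ⟨add_nonneg ht.1 (mul_nonneg hs hu.1.le),
      add_le_add ht.2 (mul_le_of_le_one_right hs hu.2)⟩).mul_right
        (Complex.exp (-(2 * π * Complex.I * s * u * η)))
    have e : ∀ k : ℤ, b k * Complex.exp (2 * π * Complex.I * k * t) *
        Complex.exp (-(2 * π * Complex.I * s * u * (η - k : ℝ))) =
        b k * Complex.exp (2 * π * Complex.I * k * (t + s * u : ℝ)) *
          Complex.exp (-(2 * π * Complex.I * s * u * η)) := by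
      intro k
      rw [mul_assoc (b k), mul_assoc (b k), ← Complex.exp_add, ← Complex.exp_add]
      congr 2
      push_cast
      ring
    have e' : A * Complex.exp (2 * π * Complex.I * η * t) =
        A * Complex.exp (2 * π * Complex.I * η * (t + s * u : ℝ)) *
          Complex.exp (-(2 * π * Complex.I * s * u * η)) := by
      rw [mul_assoc A, ← Complex.exp_add]
      congr 2
      push_cast
      ring
    simp only [e]
    rw [e']
    exact h1

lemma norm_two_pi_I_mul_pow (x : ℝ) (m : ℕ) :
    ‖(2 * π * Complex.I * x : ℂ) ^ m‖ = (2 * π * |x|) ^ m := by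
  simp [abs_of_pos Real.pi_pos]

lemma norm_exp_two_pi_I_mul (x t : ℝ) : ‖Complex.exp (2 * π * Complex.I * x * t)‖ = 1 := by
  rw [show 2 * (π : ℂ) * Complex.I * x * t = ((2 * π * x * t : ℝ) : ℂ) * Complex.I by
    push_cast; ring]
  exact Complex.norm_exp_ofReal_mul_I _

lemma norm_windowSymbol_pow_le {K : ℕ} {ζ : ℝ} (hζ : (K : ℝ) / 2 ≤ |ζ|) (hζ0 : ζ ≠ 0) :
    ‖windowSymbol (1 / (8 * ⌊(K : ℝ) / 18⌋₊)) ζ‖ ^ ⌊(K : ℝ) / 18⌋₊ ≤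
      Real.exp (1 - (K : ℝ) / 18) := by
  set n := ⌊(K : ℝ) / 18⌋₊ with hn
  have hlt : (K : ℝ) / 18 < n + 1 := Nat.lt_floor_add_one _
  rcases Nat.eq_zero_or_pos n with h0 | hpos
  · rw [h0, pow_zero]
    rw [h0] at hlt
    norm_num at hlt
    exact Real.one_le_exp (by linarith)
  · have hn' : (0 : ℝ) < n := by exact_mod_cast hpos
    have hle : (n : ℝ) ≤ K / 18 := Nat.floor_le (by positivity)
    have h1 : ‖windowSymbol (1 / (8 * n)) ζ‖ ≤ Real.exp (-1) := by
      refine (norm_windowSymbol_le (by positivity) hζ0).trans ?_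
      have hq : (9 : ℝ) / 8 * 3 ≤ π * (1 / (8 * n)) * |ζ| := by
        have h9 : 9 * (n : ℝ) ≤ |ζ| := by linarith
        have : π * (1 / (8 * n)) * (9 * n) ≤ π * (1 / (8 * n)) * |ζ| := by gcongr
        have e : π * (1 / (8 * (n : ℝ))) * (9 * n) = 9 / 8 * π := by field_simp
        linarith [Real.pi_gt_three]
      have he := Real.exp_one_lt_d9
      rw [Real.exp_neg, ← one_div]
      exact one_div_le_one_div_of_le (Real.exp_pos _) (by linarith)
    calc _ ≤ Real.exp (-1) ^ n := by gcongr
      _ = Real.exp (-n) := by rw [← Real.exp_nat_mul]; ring_nf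
      _ ≤ _ := Real.exp_le_exp.2 (by linarith)

/-- Truncated sampling expansions of exponentials with bounded coefficients and an error that is
exponentially small in the number of samples. -/
lemma exists_truncated_kernel :
    ∃ C₀ : ℝ, 0 < C₀ ∧ ∃ C : ℕ → ℝ, (∀ m, 0 ≤ C m) ∧ ∀ K : ℕ, ∃ h : ℝ → ℂ, Continuous h ∧
      (∀ η : ℝ, ∑ k ∈ Finset.Icc (-K : ℤ) K, ‖h (η - k)‖ ≤ C₀) ∧
      ∀ (m : ℕ) (η : ℝ), |η| ≤ (K : ℝ) / 2 → ∀ t ∈ Set.Icc (0 : ℝ) (1 / 8),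
        ‖(2 * π * Complex.I * η) ^ m * Complex.exp (2 * π * Complex.I * η * t) -
          ∑ k ∈ Finset.Icc (-K : ℤ) K, h (η - k) * (2 * π * Complex.I * k) ^ m *
            Complex.exp (2 * π * Complex.I * k * t)‖ ≤ C m * Real.exp (-((K : ℝ) / 18)) := by
  obtain ⟨h₀, hcont, hdec, hrep⟩ := exists_reproducing_kernel
  obtain ⟨S, hS, hsq⟩ := exists_tsum_shift_inv_sq_le
  choose D hD using hdec
  have hD0 : ∀ m, 0 ≤ D m := fun m => le_trans (by positivity) (hD m 0)
  have hdiv : ∀ (m : ℕ) (ζ : ℝ), (1 + |ζ|) ^ m * ‖h₀ ζ‖ ≤ D (m + 2) * ((1 + |ζ|) ^ 2)⁻¹ := by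
    intro m ζ
    rw [← div_eq_mul_inv, le_div_iff₀ (by positivity)]
    calc _ = (1 + |ζ|) ^ (m + 2) * ‖h₀ ζ‖ := by ring
      _ ≤ _ := hD _ _
  refine ⟨D 2 * S + 1, by have := mul_nonneg (hD0 2) hS.le; linarith,
    fun m => Real.exp 1 * (4 * π) ^ m * D (m + 2) * S,
    fun m => by have := hD0 (m + 2); positivity, fun K => ?_⟩
  set n := ⌊(K : ℝ) / 18⌋₊ with hn
  set s : ℝ := 1 / (8 * n) with hs
  have hs0 : 0 ≤ s := by positivity
  have hnle : ∀ ζ j, ‖windowSymbol s ζ ^ j * h₀ ζ‖ ≤ ‖h₀ ζ‖ := by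
    intro ζ j
    rw [norm_mul, norm_pow]
    exact mul_le_of_le_one_left (norm_nonneg _)
      (pow_le_one₀ (norm_nonneg _) (norm_windowSymbol_le_one s ζ))
  refine ⟨fun ζ => windowSymbol s ζ ^ n * h₀ ζ,
    ((continuous_windowSymbol s).pow n).mul hcont, fun η => ?_, fun m η hη t ht => ?_⟩
  · have hsum := (hsq η).1.mul_left (D 2)
    calc ∑ k ∈ Finset.Icc (-K : ℤ) K, ‖windowSymbol s (η - k) ^ n * h₀ (η - k)‖
        ≤ ∑ k ∈ Finset.Icc (-K : ℤ) K, D 2 * ((1 + |η - k|) ^ 2)⁻¹ := by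
          refine Finset.sum_le_sum fun k _ => (hnle _ _).trans ?_
          simpa using hdiv 0 (η - k)
      _ ≤ ∑' k : ℤ, D 2 * ((1 + |η - k|) ^ 2)⁻¹ :=
          hsum.sum_le_tsum _ fun k _ => mul_nonneg (hD0 2) (by positivity)
      _ ≤ D 2 * S := by
          rw [tsum_mul_left]
          exact mul_le_mul_of_nonneg_left (hsq η).2 (hD0 2)
      _ ≤ _ := by linarith
  · have hiter : ∀ (j : ℕ) (a : ℝ), a + j * s ≤ 1 / 4 → ∀ t ∈ Set.Icc 0 a,
        HasSum (fun k : ℤ => windowSymbol s (η - k) ^ j * h₀ (η - k) *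
          (2 * π * Complex.I * k) ^ m * Complex.exp (2 * π * Complex.I * k * t))
          ((2 * π * Complex.I * η) ^ m * Complex.exp (2 * π * Complex.I * η * t)) := by
      intro j
      induction j with
      | zero =>
        intro a ha t ht
        simpa using hrep η m t ⟨ht.1, ht.2.trans (by simpa using ha)⟩
      | succ j ih =>
        intro a ha t ht
        push_cast at ha
        have hb : Summable fun k : ℤ => ‖windowSymbol s (η - k) ^ j * h₀ (η - k) *
            (2 * π * Complex.I * k) ^ m‖ := by
          refine Summable.of_nonneg_of_le (fun k => norm_nonneg _) (fun k => ?_)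
            ((hsq η).1.mul_left ((2 * π * (1 + |η|)) ^ m * D (m + 2)))
          have hk : |(k : ℝ)| ≤ (1 + |η|) * (1 + |η - k|) := by
            have := abs_sub_abs_le_abs_sub (k : ℝ) η
            rw [abs_sub_comm] at this
            nlinarith [abs_nonneg η, abs_nonneg (η - k)]
          rw [norm_mul]
          have e := norm_two_pi_I_mul_pow k m
          push_cast at e
          rw [e]
          calc _ ≤ ‖h₀ (η - k)‖ * (2 * π * ((1 + |η|) * (1 + |η - k|))) ^ m := by
                gcongr
                exact hnle _ _
            _ = (2 * π * (1 + |η|)) ^ m * ((1 + |η - k|) ^ m * ‖h₀ (η - k)‖) := by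
                rw [← mul_assoc (2 * π), mul_pow]; ring
            _ ≤ (2 * π * (1 + |η|)) ^ m * (D (m + 2) * ((1 + |η - k|) ^ 2)⁻¹) :=
              mul_le_mul_of_nonneg_left (hdiv m _) (by positivity)
            _ = _ := by ring
        have := hasSum_windowSymbol_mul (A := (2 * π * Complex.I * η) ^ m) hs0 hb
          (ih (a + s) (by linarith)) t ht
        convert this using 3
        ring
    have hns : 1 / 8 + n * s ≤ 1 / 4 := by
      rcases Nat.eq_zero_or_pos n with h0 | hpos
      · simp [h0]; norm_num
      · have : (0 : ℝ) < n := by exact_mod_cast hpos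
        have : n * s = 1 / 8 := by rw [hs]; field_simp
        linarith
    have hsum := hiter n (1 / 8) hns t ht
    set g : ℤ → ℂ := fun k => windowSymbol s (η - k) ^ n * h₀ (η - k) *
          (2 * π * Complex.I * k) ^ m * Complex.exp (2 * π * Complex.I * k * t) with hg
    have hfin : HasSum (fun k => if k ∈ Finset.Icc (-K : ℤ) K then g k else 0)
        (∑ k ∈ Finset.Icc (-K : ℤ) K, g k) := by
      have := hasSum_sum_of_ne_finset_zero (L := .unconditional ℤ) (s := Finset.Icc (-K : ℤ) K)
        (f := fun k => if k ∈ Finset.Icc (-K : ℤ) K then g k else 0)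
        (fun k hk => if_neg hk)
      rwa [Finset.sum_congr rfl fun k hk => if_pos hk] at this
    have hbd := ((hsq η).1.mul_left
      (Real.exp (1 - (K : ℝ) / 18) * (4 * π) ^ m * D (m + 2))).hasSum
    refine ((hsum.sub hfin).norm_le_of_bounded hbd fun k => ?_).trans ?_
    · split_ifs with hk
      · rw [sub_self, norm_zero]
        have := hD0 (m + 2)
        positivity
      · have hkK : (K : ℝ) < |(k : ℝ)| := by
          rw [Finset.mem_Icc, ← abs_le, not_le] at hk
          exact_mod_cast hk
        have hkζ : |(k : ℝ)| ≤ 2 * |η - k| := by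
          have := abs_sub_abs_le_abs_sub (k : ℝ) η
          rw [abs_sub_comm] at this
          linarith
        have hζ : (K : ℝ) / 2 ≤ |η - k| := by linarith
        have hζ0 : η - k ≠ 0 := by
          rw [← abs_pos]
          have : (0 : ℝ) ≤ K := by positivity
          linarith
        have e := norm_two_pi_I_mul_pow k m
        have e' := norm_exp_two_pi_I_mul k t
        push_cast at e e'
        rw [sub_zero, hg, norm_mul, norm_mul, norm_mul, norm_pow, e, e', mul_one]
        calc _ ≤ Real.exp (1 - (K : ℝ) / 18) * ‖h₀ (η - k)‖ * (2 * π * (2 * (1 + |η - k|))) ^ m := by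
              gcongr
              · exact norm_windowSymbol_pow_le hζ hζ0
              · linarith
          _ = Real.exp (1 - (K : ℝ) / 18) * (4 * π) ^ m * ((1 + |η - k|) ^ m * ‖h₀ (η - k)‖) := by
              rw [show 2 * π * (2 * (1 + |η - k|)) = 4 * π * (1 + |η - k|) by ring, mul_pow]; ring
          _ ≤ Real.exp (1 - (K : ℝ) / 18) * (4 * π) ^ m *
              (D (m + 2) * ((1 + |η - k|) ^ 2)⁻¹) :=
              mul_le_mul_of_nonneg_left (hdiv m _) (by positivity)
          _ = _ := by ring
    · rw [tsum_mul_left, sub_eq_add_neg, Real.exp_add]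
      have := hD0 (m + 2)
      calc _ ≤ Real.exp 1 * Real.exp (-((K : ℝ) / 18)) * (4 * π) ^ m * D (m + 2) * S := by
            gcongr
            exact (hsq η).2
        _ = _ := by ring

lemma exists_pow_le_mul_exp_rpow {a β : ℝ} (ha : 0 < a) (hβ : 0 < β) (q : ℕ) :
    ∃ E : ℝ, 0 < E ∧ ∀ r : ℝ, 0 ≤ r → (1 + r) ^ q ≤ E * Real.exp (a * r ^ β) := by
  set k := ⌈(q : ℝ) / β⌉₊
  have hk : (q : ℝ) ≤ β * k := by
    have := Nat.le_ceil ((q : ℝ) / β)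
    rw [div_le_iff₀ hβ] at this
    linarith
  refine ⟨2 ^ q * (1 + k.factorial / a ^ k), by positivity, fun r hr => ?_⟩
  have hrβ : 0 ≤ a * r ^ β := mul_nonneg ha.le (Real.rpow_nonneg hr _)
  rcases le_total r 1 with h1 | h1
  · calc (1 + r) ^ q ≤ 2 ^ q := by gcongr; linarith
      _ = 2 ^ q * 1 * 1 := by ring
      _ ≤ _ := by
        gcongr
        · exact le_add_of_nonneg_right (by positivity)
        · exact Real.one_le_exp hrβ
  · have hexp : (r ^ β) ^ k ≤ k.factorial / a ^ k * Real.exp (a * r ^ β) := by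
      have := Real.pow_div_factorial_le_exp (a * r ^ β) hrβ k
      rw [mul_pow, div_le_iff₀ (by positivity)] at this
      rw [div_mul_eq_mul_div, le_div_iff₀ (by positivity)]
      linarith
    have hrq : r ^ q ≤ (r ^ β) ^ k := by
      rw [← Real.rpow_natCast (r ^ β), ← Real.rpow_mul hr, ← Real.rpow_natCast r]
      exact Real.rpow_le_rpow_of_exponent_le h1 hk
    calc (1 + r) ^ q ≤ (2 * r) ^ q := by gcongr; linarith
      _ = 2 ^ q * r ^ q := mul_pow ..
      _ ≤ 2 ^ q * (k.factorial / a ^ k * Real.exp (a * r ^ β)) := by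
        gcongr; exact hrq.trans hexp
      _ ≤ 2 ^ q * ((1 + k.factorial / a ^ k) * Real.exp (a * r ^ β)) := by
        gcongr; linarith
      _ = _ := by ring

lemma norm_prod_sub_prod_le_of_bounds {ι : Type*} (s : Finset ι) {A B : ι → ℂ} {P δ : ℝ}
    (hP : 1 ≤ P) (hδ : 0 ≤ δ) (hA : ∀ i, ‖A i‖ ≤ P) (hB : ∀ i, ‖B i‖ ≤ P)
    (hAB : ∀ i, ‖A i - B i‖ ≤ δ) :
    ‖∏ i ∈ s, A i - ∏ i ∈ s, B i‖ ≤ s.card * P ^ s.card * δ := by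
  classical
  induction s using Finset.induction_on with
  | empty => simp
  | insert i s hi ih =>
    rw [Finset.prod_insert hi, Finset.prod_insert hi, Finset.card_insert_of_notMem hi]
    have hBs : ‖∏ i ∈ s, B i‖ ≤ P ^ s.card := by
      rw [norm_prod]
      exact (Finset.prod_le_prod (fun i _ => norm_nonneg _) fun i _ => hB i).trans_eq (by simp)
    calc ‖A i * ∏ j ∈ s, A j - B i * ∏ j ∈ s, B j‖
        = ‖A i * (∏ j ∈ s, A j - ∏ j ∈ s, B j) + (A i - B i) * ∏ j ∈ s, B j‖ := by
          congr 1; ring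
      _ ≤ P * (s.card * P ^ s.card * δ) + δ * P ^ s.card := by
          refine (norm_add_le _ _).trans ?_
          rw [norm_mul, norm_mul]
          gcongr
          · exact hA i
          · exact hAB i
      _ ≤ P * (s.card * P ^ s.card * δ) + δ * (P ^ s.card * P) := by
          gcongr
          exact le_mul_of_one_le_right (by positivity) hP
      _ = _ := by push_cast; ring

lemma planeSymbol_eq_prod {d : ℕ} (L : List (Fin d)) (p : EuclideanSpace ℝ (Fin d)) :
    planeSymbol L p = ∏ i, (2 * π * Complex.I * (p i : ℂ)) ^ L.count i := by
  rw [planeSymbol, Finset.prod_list_map_count]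
  refine Finset.prod_subset (Finset.subset_univ _) fun i _ hi => ?_
  rw [List.mem_toFinset] at hi
  rw [List.count_eq_zero_of_not_mem hi, pow_zero]

lemma planeWave_eq_prod {d : ℕ} (p x : EuclideanSpace ℝ (Fin d)) :
    planeWave p x = ∏ i, Complex.exp (2 * π * Complex.I * p i * x i) := by
  rw [planeWave, ← Complex.exp_sum, PiLp.inner_apply]
  congr 1
  push_cast
  rw [Finset.mul_sum, Finset.mul_sum]
  refine Finset.sum_congr rfl fun i _ => ?_
  simp
  ring

/-- The frequency `k / 8` for an integer vector `k` with entries in `[-K, K]`. -/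
def gridFreq {d K : ℕ} (k : Fin d → Finset.Icc (-K : ℤ) K) : EuclideanSpace ℝ (Fin d) :=
  WithLp.toLp 2 fun i => ((k i : ℤ) : ℝ) / 8

lemma sum_gridFreq_eq_prod {d K : ℕ} (h : ℝ → ℂ) (L : List (Fin d))
    (v x : EuclideanSpace ℝ (Fin d)) :
    ∑ k : Fin d → Finset.Icc (-K : ℤ) K, (∏ i, h (8 * v i - (k i : ℤ))) *
        planeSymbol L (gridFreq k) * planeWave (gridFreq k) x =
      ∏ i, ∑ k ∈ Finset.Icc (-K : ℤ) K, h (8 * v i - k) *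
        (2 * π * Complex.I * ((k / 8 : ℝ) : ℂ)) ^ L.count i *
          Complex.exp (2 * π * Complex.I * ((k / 8 : ℝ) : ℂ) * x i) := by
  have e : ∀ i, ∑ k ∈ Finset.Icc (-K : ℤ) K, h (8 * v i - k) *
        (2 * π * Complex.I * ((k / 8 : ℝ) : ℂ)) ^ L.count i *
          Complex.exp (2 * π * Complex.I * ((k / 8 : ℝ) : ℂ) * x i) =
      ∑ k : Finset.Icc (-K : ℤ) K, h (8 * v i - (k : ℤ)) *
        (2 * π * Complex.I * (((k : ℤ) / 8 : ℝ) : ℂ)) ^ L.count i *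
          Complex.exp (2 * π * Complex.I * (((k : ℤ) / 8 : ℝ) : ℂ) * x i) := fun i =>
    (Finset.sum_coe_sort (Finset.Icc (-K : ℤ) K) _).symm
  simp only [e, Finset.prod_univ_sum, Fintype.piFinset_univ]
  refine Finset.sum_congr rfl fun k _ => ?_
  rw [planeSymbol_eq_prod, planeWave_eq_prod, Finset.prod_mul_distrib, Finset.prod_mul_distrib]
  rfl

lemma norm_planeSymbol_mul_sub_sum_le {d K : ℕ} {C : ℕ → ℝ} (hC : ∀ m, 0 ≤ C m) {h : ℝ → ℂ}
    (happ : ∀ (m : ℕ) (η : ℝ), |η| ≤ (K : ℝ) / 2 → ∀ t ∈ Set.Icc (0 : ℝ) (1 / 8),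
        ‖(2 * π * Complex.I * η) ^ m * Complex.exp (2 * π * Complex.I * η * t) -
          ∑ k ∈ Finset.Icc (-K : ℤ) K, h (η - k) * (2 * π * Complex.I * k) ^ m *
            Complex.exp (2 * π * Complex.I * k * t)‖ ≤ C m * Real.exp (-((K : ℝ) / 18)))
    (L : List (Fin d)) {v x : EuclideanSpace ℝ (Fin d)} (hv : 16 * ‖v‖ ≤ K) (hx : x ∈ unitCube d) :
    ‖planeSymbol L v * planeWave v x - ∑ k : Fin d → Finset.Icc (-K : ℤ) K,
        (∏ i, h (8 * v i - (k i : ℤ))) * planeSymbol L (gridFreq k) * planeWave (gridFreq k) x‖ ≤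
      d * ((1 + ∑ m ∈ Finset.range (L.length + 1), C m) * (2 * π * (1 + ‖v‖)) ^ L.length) ^ d *
        ((∑ m ∈ Finset.range (L.length + 1), C m) * Real.exp (-((K : ℝ) / 18))) := by
  set T := ∑ m ∈ Finset.range (L.length + 1), C m with hT
  have hT0 : 0 ≤ T := Finset.sum_nonneg fun m _ => hC m
  have hCT : ∀ m ≤ L.length, C m ≤ T := fun m hm =>
    Finset.single_le_sum (f := C) (fun m _ => hC m) (Finset.mem_range.2 (by omega))
  have hexp1 : Real.exp (-((K : ℝ) / 18)) ≤ 1 := Real.exp_le_one_iff.2 (by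
    have : (0 : ℝ) ≤ K := by positivity
    linarith)
  have hbase : 1 ≤ 2 * π * (1 + ‖v‖) := by
    nlinarith [Real.pi_gt_three, norm_nonneg v, mul_nonneg Real.pi_pos.le (norm_nonneg v)]
  have hbase' : 1 ≤ (2 * π * (1 + ‖v‖)) ^ L.length := one_le_pow₀ hbase
  have hvi : ∀ i, |v i| ≤ ‖v‖ := fun i => PiLp.norm_apply_le v i
  rw [sum_gridFreq_eq_prod, planeSymbol_eq_prod, planeWave_eq_prod, ← Finset.prod_mul_distrib]
  set A : Fin d → ℂ := fun i => (2 * π * Complex.I * (v i : ℂ)) ^ L.count i *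
    Complex.exp (2 * π * Complex.I * v i * x i) with hA
  set B : Fin d → ℂ := fun i => ∑ k ∈ Finset.Icc (-K : ℤ) K, h (8 * v i - k) *
        (2 * π * Complex.I * ((k / 8 : ℝ) : ℂ)) ^ L.count i *
          Complex.exp (2 * π * Complex.I * ((k / 8 : ℝ) : ℂ) * x i) with hB
  have hAB : ∀ i, ‖A i - B i‖ ≤ T * Real.exp (-((K : ℝ) / 18)) := by
    intro i
    have h8 : |8 * v i| ≤ (K : ℝ) / 2 := by
      rw [abs_mul, abs_of_pos (by norm_num : (0 : ℝ) < 8)]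
      linarith [hvi i]
    have ht : x i / 8 ∈ Set.Icc (0 : ℝ) (1 / 8) := by
      have := hx i
      exact ⟨by linarith [this.1], by linarith [this.2]⟩
    have := happ (L.count i) (8 * v i) h8 (x i / 8) ht
    have e : (2 * π * Complex.I * ((8 * v i : ℝ) : ℂ)) ^ L.count i *
          Complex.exp (2 * π * Complex.I * ((8 * v i : ℝ) : ℂ) * ((x i / 8 : ℝ) : ℂ)) -
          ∑ k ∈ Finset.Icc (-K : ℤ) K, h (8 * v i - k) * (2 * π * Complex.I * k) ^ L.count i *
            Complex.exp (2 * π * Complex.I * k * ((x i / 8 : ℝ) : ℂ)) =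
        8 ^ L.count i * (A i - B i) := by
      rw [hA, hB, mul_sub, Finset.mul_sum]
      congr 1
      · rw [← mul_assoc, ← mul_pow]
        congr 2 <;> (push_cast; ring)
      · refine Finset.sum_congr rfl fun k _ => ?_
        have : (2 * π * Complex.I * (k : ℂ)) ^ L.count i =
            8 ^ L.count i * (2 * π * Complex.I * ((k / 8 : ℝ) : ℂ)) ^ L.count i := by
          rw [← mul_pow]
          congr 1
          push_cast
          ring
        rw [this, show 2 * π * Complex.I * (k : ℂ) * ((x i / 8 : ℝ) : ℂ) =
          2 * π * Complex.I * ((k / 8 : ℝ) : ℂ) * x i by push_cast; ring]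
        ring
    rw [e, norm_mul, norm_pow, Complex.norm_ofNat] at this
    calc ‖A i - B i‖ ≤ 8 ^ L.count i * ‖A i - B i‖ :=
          le_mul_of_one_le_left (norm_nonneg _) (one_le_pow₀ (by norm_num))
      _ ≤ C (L.count i) * Real.exp (-((K : ℝ) / 18)) := this
      _ ≤ _ := by
          gcongr
          exact hCT _ List.count_le_length
  have hAle : ∀ i, ‖A i‖ ≤ (2 * π * (1 + ‖v‖)) ^ L.length := by
    intro i
    rw [hA, norm_mul, norm_two_pi_I_mul_pow, norm_exp_two_pi_I_mul, mul_one]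
    calc (2 * π * |v i|) ^ L.count i ≤ (2 * π * (1 + ‖v‖)) ^ L.count i := by
          gcongr; linarith [hvi i]
      _ ≤ _ := pow_le_pow_right₀ hbase List.count_le_length
  have hP : (2 * π * (1 + ‖v‖)) ^ L.length + T ≤ (1 + T) * (2 * π * (1 + ‖v‖)) ^ L.length := by
    nlinarith
  have hBle : ∀ i, ‖B i‖ ≤ (1 + T) * (2 * π * (1 + ‖v‖)) ^ L.length := by
    intro i
    have h1 := norm_sub_norm_le (B i) (A i)
    rw [norm_sub_rev] at h1
    have := mul_le_of_le_one_right hT0 hexp1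
    linarith [hAB i, hAle i]
  have := norm_prod_sub_prod_le_of_bounds Finset.univ (A := A) (B := B)
    (P := (1 + T) * (2 * π * (1 + ‖v‖)) ^ L.length) (by nlinarith)
    (mul_nonneg hT0 (Real.exp_pos _).le) (fun i => (hAle i).trans (by nlinarith)) hBle hAB
  simpa using this

lemma rpow_natCast_le_self {β : ℝ} (hβ0 : 0 < β) (hβ1 : β < 1) (K : ℕ) : (K : ℝ) ^ β ≤ K := by
  rcases Nat.eq_zero_or_pos K with h | h
  · simp [h, Real.zero_rpow hβ0.ne']
  · have h1 : (1 : ℝ) ≤ K := by exact_mod_cast h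
    simpa using Real.rpow_le_rpow_of_exponent_le h1 hβ1.le

lemma sum_prod_norm_grid_le {d K : ℕ} {h : ℝ → ℂ} {C₀ : ℝ}
    (hC₀ : ∀ η : ℝ, ∑ k ∈ Finset.Icc (-K : ℤ) K, ‖h (η - k)‖ ≤ C₀)
    (v : EuclideanSpace ℝ (Fin d)) :
    ∑ k : Fin d → Finset.Icc (-K : ℤ) K, ‖∏ i, h (8 * v i - (k i : ℤ))‖ ≤ C₀ ^ d := by
  have e : ∑ k : Fin d → Finset.Icc (-K : ℤ) K, ‖∏ i, h (8 * v i - (k i : ℤ))‖ =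
      ∏ i, ∑ k : Finset.Icc (-K : ℤ) K, ‖h (8 * v i - (k : ℤ))‖ := by
    rw [Finset.prod_univ_sum, Fintype.piFinset_univ]
    exact Finset.sum_congr rfl fun k _ => norm_prod _ _
  rw [e]
  refine (Finset.prod_le_prod (fun i _ => Finset.sum_nonneg fun _ _ => norm_nonneg _)
    fun i _ => ?_).trans_eq (by rw [Finset.prod_const, Finset.card_univ, Fintype.card_fin])
  exact (Finset.sum_coe_sort (Finset.Icc (-K : ℤ) K) fun k => ‖h (8 * v i - k)‖).trans_le (hC₀ _)

lemma integrable_one_add_norm_pow_mul {d : ℕ} {c β : ℝ} (hc : 0 < c) (hβ : 0 < β)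
    {w : EuclideanSpace ℝ (Fin d) → ℂ} (hw : Continuous w)
    (hwi : Integrable fun v => Real.exp (c * ‖v‖ ^ β) * ‖w v‖) (m : ℕ) :
    Integrable fun v => (1 + ‖v‖) ^ m * ‖w v‖ := by
  obtain ⟨E, hE, hEm⟩ := exists_pow_le_mul_exp_rpow hc hβ m
  refine (hwi.const_mul E).mono' (by fun_prop : Continuous _).aestronglyMeasurable
    (.of_forall fun v => ?_)
  rw [Real.norm_of_nonneg (by positivity), ← mul_assoc]
  gcongr
  exact hEm _ (norm_nonneg v)

/-- The sampling coefficients of `w` restricted to a ball. -/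
def gridCoeff {d K : ℕ} (w : EuclideanSpace ℝ (Fin d) → ℂ) (h : ℝ → ℂ)
    (k : Fin d → Finset.Icc (-K : ℤ) K) : ℂ :=
  ∫ v in Metric.closedBall (0 : EuclideanSpace ℝ (Fin d)) (K / 16),
    w v * ∏ i, h (8 * v i - (k i : ℤ))

lemma sum_norm_gridCoeff_le {d K : ℕ} {w : EuclideanSpace ℝ (Fin d) → ℂ} (hw : Continuous w)
    (hwi : Integrable fun v => ‖w v‖) {h : ℝ → ℂ} (hh : Continuous h) {C₀ : ℝ} (hC : 0 ≤ C₀)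
    (hC₀ : ∀ η : ℝ, ∑ k ∈ Finset.Icc (-K : ℤ) K, ‖h (η - k)‖ ≤ C₀) :
    ∑ k : Fin d → Finset.Icc (-K : ℤ) K, ‖gridCoeff w h k‖ ≤ C₀ ^ d * ∫ v, ‖w v‖ := by
  have hint : ∀ k : Fin d → Finset.Icc (-K : ℤ) K, IntegrableOn
      (fun v : EuclideanSpace ℝ (Fin d) => ‖w v * ∏ i, h (8 * v i - (k i : ℤ))‖)
      (Metric.closedBall 0 (K / 16)) := fun k =>
    ((by fun_prop : Continuous _).continuousOn).integrableOn_compact (isCompact_closedBall _ _)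
  calc ∑ k : Fin d → Finset.Icc (-K : ℤ) K, ‖gridCoeff w h k‖
      ≤ ∑ k : Fin d → Finset.Icc (-K : ℤ) K,
          ∫ v in Metric.closedBall (0 : EuclideanSpace ℝ (Fin d)) (K / 16),
            ‖w v * ∏ i, h (8 * v i - (k i : ℤ))‖ :=
        Finset.sum_le_sum fun k _ => norm_integral_le_integral_norm _
    _ = ∫ v in Metric.closedBall (0 : EuclideanSpace ℝ (Fin d)) (K / 16),
          ∑ k : Fin d → Finset.Icc (-K : ℤ) K, ‖w v * ∏ i, h (8 * v i - (k i : ℤ))‖ :=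
        (integral_finsetSum _ fun k _ => hint k).symm
    _ ≤ ∫ v in Metric.closedBall (0 : EuclideanSpace ℝ (Fin d)) (K / 16), C₀ ^ d * ‖w v‖ := by
        refine integral_mono (integrable_finsetSum _ fun k _ => hint k)
          (hwi.const_mul _).integrableOn fun v => ?_
        simp only [norm_mul, ← Finset.mul_sum]
        rw [mul_comm]
        exact mul_le_mul_of_nonneg_right (sum_prod_norm_grid_le hC₀ v) (norm_nonneg _)
    _ ≤ ∫ v, C₀ ^ d * ‖w v‖ :=
        setIntegral_le_integral (hwi.const_mul _) (.of_forall fun v => by positivity)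
    _ = _ := integral_const_mul _ _

lemma errorTower_gridCoeff_eq {d K : ℕ} {w : EuclideanSpace ℝ (Fin d) → ℂ} (hw : Continuous w)
    (hwi : ∀ m : ℕ, Integrable fun v => (1 + ‖v‖) ^ m * ‖w v‖) {h : ℝ → ℂ} (hh : Continuous h)
    (L : List (Fin d)) (x : EuclideanSpace ℝ (Fin d)) :
    errorTower w (gridCoeff (K := K) w h) gridFreq L x =
      ∫ v, (w v * planeSymbol L v * planeWave v x -
        (Metric.closedBall (0 : EuclideanSpace ℝ (Fin d)) (K / 16)).indicator (fun v => w v *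
          ∑ k : Fin d → Finset.Icc (-K : ℤ) K, (∏ i, h (8 * v i - (k i : ℤ))) *
            planeSymbol L (gridFreq k) * planeWave (gridFreq k) x) v) := by
  have hS := continuous_planeSymbol L
  have hW : Continuous fun v => planeWave v x :=
    continuous_planeWave.comp (by fun_prop : Continuous fun v => (v, x))
  have h1 : Integrable fun v => w v * planeSymbol L v * planeWave v x := by
    refine (integrable_pow_mul_symbol hw hwi L).mono' (by fun_prop : Continuous _).aestronglyMeasurable
      (.of_forall fun v => ?_)
    rw [norm_mul, norm_planeWave, mul_one]
    exact le_mul_of_one_le_left (norm_nonneg _) (by linarith [norm_nonneg v])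
  have hint : ∀ k : Fin d → Finset.Icc (-K : ℤ) K, IntegrableOn
      (fun v : EuclideanSpace ℝ (Fin d) => w v * ∏ i, h (8 * v i - (k i : ℤ)))
      (Metric.closedBall 0 (K / 16)) := fun k =>
    ((by fun_prop : Continuous _).continuousOn).integrableOn_compact (isCompact_closedBall _ _)
  have h2 : IntegrableOn (fun v : EuclideanSpace ℝ (Fin d) => w v *
          ∑ k : Fin d → Finset.Icc (-K : ℤ) K, (∏ i, h (8 * v i - (k i : ℤ))) *
            planeSymbol L (gridFreq k) * planeWave (gridFreq k) x) (Metric.closedBall 0 (K / 16)) :=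
    ((by fun_prop : Continuous _).continuousOn).integrableOn_compact (isCompact_closedBall _ _)
  rw [integral_sub h1 ((integrable_indicator_iff measurableSet_closedBall).2 h2),
    integral_indicator measurableSet_closedBall, errorTower]
  congr 1
  simp only [gridCoeff, Finset.mul_sum, ← integral_mul_const]
  rw [← integral_finsetSum _ fun k _ => ((hint k).mul_const _).mul_const _]
  congr 1
  ext v
  exact Finset.sum_congr rfl fun k _ => by ring

lemma exists_gridCoeff_error_le (d : ℕ) {c β : ℝ} (hc : 0 < c) (hβ0 : 0 < β) (hβ1 : β < 1) :
    ∃ C₀ : ℝ, 0 < C₀ ∧ ∃ c₁ : ℝ, 0 < c₁ ∧ ∃ C : ℕ → ℝ, (∀ m, 0 ≤ C m) ∧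
      ∀ w : EuclideanSpace ℝ (Fin d) → ℂ, Continuous w →
        Integrable (fun v => Real.exp (c * ‖v‖ ^ β) * ‖w v‖) → ∀ K : ℕ,
        ∃ a : (Fin d → Finset.Icc (-K : ℤ) K) → ℂ,
          ∑ k, ‖a k‖ ≤ C₀ * ∫ v, Real.exp (c * ‖v‖ ^ β) * ‖w v‖ ∧
          ∀ L : List (Fin d), ∀ x ∈ unitCube d, ‖errorTower w a gridFreq L x‖ ≤
            C L.length * (∫ v, Real.exp (c * ‖v‖ ^ β) * ‖w v‖) *
              Real.exp (-(c₁ * (K : ℝ) ^ β)) := by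
  obtain ⟨C₀, hC₀, C, hC, hker⟩ := exists_truncated_kernel
  choose E hE hEm using exists_pow_le_mul_exp_rpow (half_pos hc) hβ0
  set T : ℕ → ℝ := fun ℓ => ∑ m ∈ Finset.range (ℓ + 1), C m with hT
  have hT0 : ∀ ℓ, 0 ≤ T ℓ := fun ℓ => Finset.sum_nonneg fun m _ => hC m
  set c₁ : ℝ := min (1 / 18) (c / 32) with hc₁
  refine ⟨C₀ ^ d, pow_pos hC₀ d, c₁, lt_min (by norm_num) (by positivity),
    fun ℓ => (d * ((1 + T ℓ) * (2 * π) ^ ℓ) ^ d * T ℓ + (2 * π) ^ ℓ) * E (ℓ * d + ℓ),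
    fun ℓ => by have := hT0 ℓ; have := hE (ℓ * d + ℓ); positivity, fun w hw hwi K => ?_⟩
  obtain ⟨h, hh, hsum, happ⟩ := hker K
  have hpoly := integrable_one_add_norm_pow_mul hc hβ0 hw hwi
  have hw0 : Integrable fun v => ‖w v‖ := by simpa using hpoly 0
  have hrβ : ∀ v : EuclideanSpace ℝ (Fin d), 0 ≤ ‖v‖ ^ β :=
    fun v => Real.rpow_nonneg (norm_nonneg v) β
  refine ⟨gridCoeff w h, (sum_norm_gridCoeff_le hw hw0 hh hC₀.le hsum).trans ?_, fun L x hx => ?_⟩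
  · refine mul_le_mul_of_nonneg_left (integral_mono hw0 hwi fun v => ?_) (by positivity)
    exact le_mul_of_one_le_left (norm_nonneg _) (Real.one_le_exp (mul_nonneg hc.le (hrβ v)))
  · rw [errorTower_gridCoeff_eq hw hpoly hh]
    set ℓ := L.length
    set P : ℝ := d * ((1 + T ℓ) * (2 * π) ^ ℓ) ^ d * T ℓ with hP
    have hP0 : 0 ≤ P := by have := hT0 ℓ; positivity
    have hE0 := hE (ℓ * d + ℓ)
    have hKβ : (0 : ℝ) ≤ (K : ℝ) ^ β := by positivity
    refine (norm_integral_le_of_norm_le (hwi.const_mul ((P + (2 * π) ^ ℓ) * E (ℓ * d + ℓ) *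
      Real.exp (-(c₁ * (K : ℝ) ^ β)))) (.of_forall fun v => ?_)).trans_eq ?_
    · have h1v : 1 ≤ 1 + ‖v‖ := by linarith [norm_nonneg v]
      have hEv := hEm (ℓ * d + ℓ) ‖v‖ (norm_nonneg v)
      by_cases hv : v ∈ Metric.closedBall (0 : EuclideanSpace ℝ (Fin d)) (K / 16)
      · rw [Set.indicator_of_mem hv, mul_assoc (w v), ← mul_sub, norm_mul]
        rw [mem_closedBall_zero_iff] at hv
        have hmain := norm_planeSymbol_mul_sub_sum_le hC happ L (v := v) (by linarith) hx
        have hexp : Real.exp (-((K : ℝ) / 18)) ≤ Real.exp (-(c₁ * (K : ℝ) ^ β)) := by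
          refine Real.exp_le_exp.2 (neg_le_neg ?_)
          calc c₁ * (K : ℝ) ^ β ≤ 1 / 18 * K :=
                mul_le_mul (min_le_left _ _) (rpow_natCast_le_self hβ0 hβ1 K) hKβ (by norm_num)
            _ = _ := by ring
        have hpow : (1 + ‖v‖) ^ (ℓ * d) ≤ E (ℓ * d + ℓ) * Real.exp (c * ‖v‖ ^ β) := by
          refine (pow_le_pow_right₀ h1v (Nat.le_add_right _ _)).trans (hEv.trans ?_)
          gcongr
          linarith
        calc _ ≤ ‖w v‖ * (d * ((1 + T ℓ) * (2 * π * (1 + ‖v‖)) ^ ℓ) ^ d *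
                (T ℓ * Real.exp (-((K : ℝ) / 18)))) := by gcongr
          _ = ‖w v‖ * (P * (1 + ‖v‖) ^ (ℓ * d) * Real.exp (-((K : ℝ) / 18))) := by
              rw [hP, mul_pow (2 * π), pow_mul, mul_pow (1 + T ℓ), mul_pow (1 + T ℓ),
                mul_pow ((2 * π) ^ ℓ)]
              ring
          _ ≤ ‖w v‖ * ((P + (2 * π) ^ ℓ) * (E (ℓ * d + ℓ) * Real.exp (c * ‖v‖ ^ β)) *
                Real.exp (-(c₁ * (K : ℝ) ^ β))) := by
              gcongr
              exact le_add_of_nonneg_right (by positivity)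
          _ = _ := by ring
      · rw [Set.indicator_of_notMem hv, sub_zero, norm_mul, norm_mul, norm_planeWave, mul_one]
        rw [mem_closedBall_zero_iff, not_le] at hv
        have hlow : c₁ * (K : ℝ) ^ β ≤ c / 2 * ‖v‖ ^ β := by
          have h16 : (1 : ℝ) / 16 ≤ (1 / 16 : ℝ) ^ β := by
            simpa using Real.rpow_le_rpow_of_exponent_ge (x := 1 / 16) (by norm_num) (by norm_num)
              hβ1.le
          calc c₁ * (K : ℝ) ^ β ≤ c / 32 * (K : ℝ) ^ β := by gcongr; exact min_le_right _ _
            _ = c / 2 * (1 / 16 * (K : ℝ) ^ β) := by ring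
            _ ≤ c / 2 * ((1 / 16) ^ β * (K : ℝ) ^ β) := by gcongr
            _ = c / 2 * (1 / 16 * (K : ℝ)) ^ β := by
                rw [Real.mul_rpow (by norm_num) (by positivity)]
            _ ≤ c / 2 * ‖v‖ ^ β := by
                gcongr
                linarith
        have hexp : Real.exp (c / 2 * ‖v‖ ^ β) ≤
            Real.exp (c * ‖v‖ ^ β) * Real.exp (-(c₁ * (K : ℝ) ^ β)) := by
          rw [← Real.exp_add]
          exact Real.exp_le_exp.2 (by linarith)
        have hpow : (1 + ‖v‖) ^ ℓ ≤ E (ℓ * d + ℓ) *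
            (Real.exp (c * ‖v‖ ^ β) * Real.exp (-(c₁ * (K : ℝ) ^ β))) := by
          refine (pow_le_pow_right₀ h1v (Nat.le_add_left _ _)).trans (hEv.trans ?_)
          gcongr
        calc _ ≤ ‖w v‖ * (2 * π * (1 + ‖v‖)) ^ ℓ := by
              gcongr
              exact norm_planeSymbol_le L v
          _ = ‖w v‖ * ((2 * π) ^ ℓ * (1 + ‖v‖) ^ ℓ) := by rw [mul_pow]
          _ ≤ ‖w v‖ * ((P + (2 * π) ^ ℓ) * (E (ℓ * d + ℓ) *
                (Real.exp (c * ‖v‖ ^ β) * Real.exp (-(c₁ * (K : ℝ) ^ β))))) := by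
              gcongr
              exact le_add_of_nonneg_left hP0
          _ = _ := by ring
    · rw [integral_const_mul]
      ring

lemma exists_grid_size {d N : ℕ} (hd : 0 < d) (hN : 1 ≤ N) {β : ℝ} (hβ0 : 0 < β) (hβ1 : β < 1) :
    ∃ K : ℕ, (2 * K + 1) ^ d ≤ N ∧ (N : ℝ) ^ (β / d) ≤ 2 * (K : ℝ) ^ β + 3 := by
  have hd' : (0 : ℝ) < d := by exact_mod_cast hd
  have hN' : (1 : ℝ) ≤ N := by exact_mod_cast hN
  set X : ℝ := (N : ℝ) ^ (1 / (d : ℝ)) with hX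
  have hX1 : 1 ≤ X := Real.one_le_rpow hN' (by positivity)
  have hXd : X ^ d = N := by
    rw [hX, ← Real.rpow_natCast, ← Real.rpow_mul (by positivity), one_div_mul_cancel hd'.ne',
      Real.rpow_one]
  set K := ⌊(X - 1) / 2⌋₊ with hK
  have hKle : (K : ℝ) ≤ (X - 1) / 2 := Nat.floor_le (by linarith)
  have hKlt : (X - 1) / 2 < K + 1 := Nat.lt_floor_add_one _
  refine ⟨K, ?_, ?_⟩
  · have : (2 * (K : ℝ) + 1) ^ d ≤ X ^ d := by gcongr; linarith
    rw [hXd] at this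
    exact_mod_cast this
  · have e : (N : ℝ) ^ (β / d) = X ^ β := by
      rw [hX, ← Real.rpow_mul (by positivity)]
      congr 1
      ring
    have two : (2 : ℝ) ^ β ≤ 2 := by
      simpa using Real.rpow_le_rpow_of_exponent_le one_le_two hβ1.le
    have three : (3 : ℝ) ^ β ≤ 3 := by
      simpa using Real.rpow_le_rpow_of_exponent_le (by norm_num : (1 : ℝ) ≤ 3) hβ1.le
    have hKβ : (0 : ℝ) ≤ (K : ℝ) ^ β := by positivity
    calc (N : ℝ) ^ (β / d) = X ^ β := e
      _ ≤ (2 * K + 3 : ℝ) ^ β := by gcongr; linarith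
      _ ≤ (2 * K : ℝ) ^ β + 3 ^ β :=
          Real.rpow_add_le_add_rpow (by positivity) (by norm_num) hβ0.le hβ1.le
      _ ≤ _ := by
          rw [Real.mul_rpow (by norm_num) (by positivity)]
          gcongr

lemma exists_fin_errorTower_eq {d N : ℕ} {ι : Type*} [Fintype ι] (hN : Fintype.card ι ≤ N)
    (w : EuclideanSpace ℝ (Fin d) → ℂ) (a : ι → ℂ) (p : ι → EuclideanSpace ℝ (Fin d)) :
    ∃ (b : Fin N → ℂ) (θ : Fin N → EuclideanSpace ℝ (Fin d)), ∑ n, ‖b n‖ = ∑ k, ‖a k‖ ∧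
      ∀ L x, errorTower w b θ L x = errorTower w a p L x := by
  obtain ⟨e⟩ : Nonempty (ι ↪ Fin N) :=
    Function.Embedding.nonempty_of_card_le (by simpa using hN)
  have hb0 : ∀ n ∉ Set.range e, Function.extend e a 0 n = 0 := fun n hn =>
    Function.extend_apply' _ _ _ fun ⟨k, hk⟩ => hn ⟨k, hk⟩
  refine ⟨Function.extend e a 0, Function.extend e p 0, ?_, fun L x => ?_⟩
  · refine (Fintype.sum_of_injective e e.injective _ _ (fun n hn => ?_) fun k => ?_).symm
    · rw [hb0 n hn, norm_zero]
    · rw [e.injective.extend_apply]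
  · rw [errorTower, errorTower]
    congr 1
    refine (Fintype.sum_of_injective e e.injective _ _ (fun n hn => ?_) fun k => ?_).symm
    · rw [hb0 n hn, zero_mul, zero_mul]
    · rw [e.injective.extend_apply, e.injective.extend_apply]

lemma exists_network_error_le {d : ℕ} (hd : 0 < d) {c β : ℝ} (hc : 0 < c) (hβ0 : 0 < β)
    (hβ1 : β < 1) :
    ∃ C₀ : ℝ, 0 < C₀ ∧ ∃ c₁ : ℝ, 0 < c₁ ∧ ∃ C : ℕ → ℝ, (∀ ℓ, 0 < C ℓ) ∧
      ∀ w : EuclideanSpace ℝ (Fin d) → ℂ, Continuous w →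
        Integrable (fun v => Real.exp (c * ‖v‖ ^ β) * ‖w v‖) → ∀ N : ℕ, 1 ≤ N →
        ∃ (a : Fin N → ℂ) (θ : Fin N → EuclideanSpace ℝ (Fin d)),
          ∑ n, ‖a n‖ ≤ C₀ * ∫ v, Real.exp (c * ‖v‖ ^ β) * ‖w v‖ ∧
          ∀ (ℓ : ℕ) (L : List (Fin d)), L.length ≤ ℓ → ∀ x ∈ unitCube d,
            ‖errorTower w a θ L x‖ ≤ C ℓ * (∫ v, Real.exp (c * ‖v‖ ^ β) * ‖w v‖) *
              Real.exp (-(c₁ * (N : ℝ) ^ (β / d))) := by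
  obtain ⟨C₀, hC₀, c₁, hc₁, C, hC, H⟩ := exists_gridCoeff_error_le d hc hβ0 hβ1
  set T : ℕ → ℝ := fun ℓ => ∑ m ∈ Finset.range (ℓ + 1), C m with hT
  have hT0 : ∀ ℓ, 0 ≤ T ℓ := fun ℓ => Finset.sum_nonneg fun m _ => hC m
  refine ⟨C₀, hC₀, c₁ / 2, half_pos hc₁, fun ℓ => (T ℓ + 1) * Real.exp (3 * c₁ / 2),
    fun ℓ => by have := hT0 ℓ; positivity, fun w hw hwi N hN => ?_⟩
  obtain ⟨K, hKN, hrate⟩ := exists_grid_size hd hN hβ0 hβ1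
  obtain ⟨a, ha, herr⟩ := H w hw hwi K
  have hcard : Fintype.card (Fin d → Finset.Icc (-K : ℤ) K) ≤ N := by
    rw [Fintype.card_fun, Fintype.card_coe, Int.card_Icc, Fintype.card_fin]
    refine le_trans (le_of_eq ?_) hKN
    congr 1
    omega
  obtain ⟨b, θ, hb, hbe⟩ := exists_fin_errorTower_eq hcard w a gridFreq
  refine ⟨b, θ, hb.trans_le ha, fun ℓ L hL x hx => ?_⟩
  rw [hbe]
  have hW : 0 ≤ ∫ v : EuclideanSpace ℝ (Fin d), Real.exp (c * ‖v‖ ^ β) * ‖w v‖ :=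
    integral_nonneg fun v => by positivity
  have hCT : C L.length ≤ T ℓ + 1 := by
    have := Finset.single_le_sum (f := C) (fun m _ => hC m)
      (Finset.mem_range.2 (Nat.lt_succ_of_le hL))
    simp only [hT]
    linarith
  have hexp : Real.exp (-(c₁ * (K : ℝ) ^ β)) ≤
      Real.exp (3 * c₁ / 2) * Real.exp (-(c₁ / 2 * (N : ℝ) ^ (β / d))) := by
    rw [← Real.exp_add]
    refine Real.exp_le_exp.2 ?_
    have := mul_le_mul_of_nonneg_left hrate (half_pos hc₁).le
    linarith
  have := hT0 ℓ
  calc _ ≤ C L.length * (∫ v, Real.exp (c * ‖v‖ ^ β) * ‖w v‖) *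
        Real.exp (-(c₁ * (K : ℝ) ^ β)) := herr L x hx
    _ ≤ (T ℓ + 1) * (∫ v, Real.exp (c * ‖v‖ ^ β) * ‖w v‖) *
        (Real.exp (3 * c₁ / 2) * Real.exp (-(c₁ / 2 * (N : ℝ) ^ (β / d)))) := by
        gcongr
    _ = _ := by ring

lemma isCompact_unitCube (d : ℕ) : IsCompact (unitCube d) := by
  have e : unitCube d = (PiLp.homeomorph 2 fun _ : Fin d => ℝ) ⁻¹'
      Set.univ.pi fun _ => Set.Icc (0 : ℝ) 1 := by
    ext x
    exact ⟨fun h i _ => h i, fun h i => h i trivial⟩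
  rw [e, Homeomorph.isCompact_preimage]
  exact isCompact_univ_pi fun _ => isCompact_Icc

lemma sobolevOn_unitCube_le {d ℓ n : ℕ} (hℓ : ℓ ≤ n) {g : EuclideanSpace ℝ (Fin d) → ℂ} {D : ℝ}
    (hD : 0 ≤ D) (h : ∀ L : List (Fin d), L.length ≤ n →
      ∀ᵐ x ∂volume.restrict (unitCube d), ‖pderivSeq L g x‖ ≤ D) :
    sobolevOn ℓ (unitCube d) g ≤
      Real.sqrt ((n + 1) ^ d * (volume.real (unitCube d) + 1)) * D := by
  have hV : 0 ≤ volume.real (unitCube d) := measureReal_nonneg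
  have hterm : ∀ α : Fin d → Fin (ℓ + 1),
      (if (∑ i, (α i : ℕ)) ≤ ℓ then
        ∫ x in unitCube d, ‖pderivMulti (fun i => (α i : ℕ)) g x‖ ^ 2 else 0) ≤
      (volume.real (unitCube d) + 1) * D ^ 2 := by
    intro α
    split_ifs with hα
    · have hlen : ((List.finRange d).flatMap fun i => List.replicate (α i : ℕ) i).length ≤ n := by
        rw [List.length_flatMap]
        simp only [List.length_replicate]
        rw [← Fin.sum_univ_def]
        exact hα.trans hℓ
      have := norm_setIntegral_le_of_norm_le_const_ae (C := D ^ 2)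
        (f := fun x => ‖pderivMulti (fun i => (α i : ℕ)) g x‖ ^ 2)
        (isCompact_unitCube d).measure_lt_top (by
          filter_upwards [h _ hlen] with x hx
          rw [Real.norm_of_nonneg (by positivity)]
          gcongr
          exact hx)
      have := (le_abs_self _).trans this
      nlinarith [sq_nonneg D]
    · positivity
  refine Real.sqrt_le_iff.2 ⟨by positivity, ?_⟩
  rw [mul_pow, Real.sq_sqrt (by positivity)]
  refine (Finset.sum_le_card_nsmul _ _ _ fun α _ => hterm α).trans ?_
  rw [Finset.card_univ, Fintype.card_fun, Fintype.card_fin, Fintype.card_fin, nsmul_eq_mul,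
    mul_assoc]
  gcongr
  push_cast
  gcongr

lemma tsum_geometric_mul_div_le {s : ℕ → ℝ} (hs : ∀ ℓ, 0 ≤ s ℓ) {n : ℕ}
    (h : ∀ ℓ ≤ n, s ℓ ≤ (2 : ℝ)⁻¹ ^ n / 2) :
    ∑' ℓ : ℕ, (2 : ℝ)⁻¹ ^ ℓ * (s ℓ / (1 + s ℓ)) ≤ 2 * (2 : ℝ)⁻¹ ^ n := by
  have hq : HasSum (fun ℓ : ℕ => (2 : ℝ)⁻¹ ^ ℓ) 2 := by simpa using hasSum_geometric_two
  have h1 : ∀ ℓ, s ℓ / (1 + s ℓ) ≤ 1 := fun ℓ => by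
    have := hs ℓ
    rw [div_le_one (by positivity)]
    linarith
  have h0 : ∀ ℓ, 0 ≤ s ℓ / (1 + s ℓ) := fun ℓ => by
    have := hs ℓ
    positivity
  have hsum : Summable fun ℓ : ℕ => (2 : ℝ)⁻¹ ^ ℓ * (s ℓ / (1 + s ℓ)) :=
    Summable.of_nonneg_of_le (fun ℓ => mul_nonneg (by positivity) (h0 ℓ))
      (fun ℓ => mul_le_of_le_one_right (by positivity) (h1 ℓ)) hq.summable
  rw [← hsum.sum_add_tsum_nat_add (n + 1)]
  have hhead : ∑ ℓ ∈ Finset.range (n + 1), (2 : ℝ)⁻¹ ^ ℓ * (s ℓ / (1 + s ℓ)) ≤ (2 : ℝ)⁻¹ ^ n := by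
    calc _ ≤ ∑ ℓ ∈ Finset.range (n + 1), (2 : ℝ)⁻¹ ^ ℓ * ((2 : ℝ)⁻¹ ^ n / 2) := by
          refine Finset.sum_le_sum fun ℓ hℓ => ?_
          exact mul_le_mul_of_nonneg_left
            ((div_le_self (hs ℓ) (by linarith [hs ℓ] : 1 ≤ 1 + s ℓ)).trans
              (h ℓ (Nat.lt_succ_iff.1 (Finset.mem_range.1 hℓ)))) (by positivity)
      _ = (∑ ℓ ∈ Finset.range (n + 1), (2 : ℝ)⁻¹ ^ ℓ) * ((2 : ℝ)⁻¹ ^ n / 2) := by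
          rw [Finset.sum_mul]
      _ ≤ 2 * ((2 : ℝ)⁻¹ ^ n / 2) := by
          gcongr
          exact sum_le_hasSum _ (fun _ _ => by positivity) hq
      _ = _ := by ring
  have htail : ∑' ℓ : ℕ, (2 : ℝ)⁻¹ ^ (ℓ + (n + 1)) * (s (ℓ + (n + 1)) / (1 + s (ℓ + (n + 1)))) ≤
      (2 : ℝ)⁻¹ ^ n := by
    have hg := hq.mul_right ((2 : ℝ)⁻¹ ^ (n + 1))
    refine (((summable_nat_add_iff (n + 1)).2 hsum).tsum_le_tsum (fun ℓ => ?_)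
      hg.summable).trans_eq ?_
    · rw [pow_add]
      exact mul_le_of_le_one_right (by positivity) (h1 _)
    · rw [hg.tsum_eq, pow_succ]
      ring
  linarith

lemma sobolevOn_sub_network_le {d N ℓ n : ℕ} (hℓ : ℓ ≤ n) {f : EuclideanSpace ℝ (Fin d) → ℝ}
    {w : EuclideanSpace ℝ (Fin d) → ℂ} (hw : Continuous w)
    (hwi : ∀ m : ℕ, Integrable fun v => (1 + ‖v‖) ^ m * ‖w v‖)
    (hf : ∀ᵐ x ∂volume.restrict (unitCube d), (f x : ℂ) = ∫ v, w v * planeWave v x)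
    (a : Fin N → ℂ) (θ : Fin N → EuclideanSpace ℝ (Fin d)) {D : ℝ} (hD : 0 ≤ D)
    (h : ∀ L : List (Fin d), L.length ≤ n → ∀ x ∈ unitCube d, ‖errorTower w a θ L x‖ ≤ D) :
    sobolevOn ℓ (unitCube d) (fun x => (f x : ℂ) - ∑ k, a k * planeWave (θ k) x) ≤
      Real.sqrt ((n + 1) ^ d * (volume.real (unitCube d) + 1)) * D := by
  have hT := hasFDerivAt_errorTower hw hwi a θ
  have hdiff : ∀ L, Differentiable ℝ (errorTower w a θ L) := fun L x =>
    (hT L x).choose_spec.1.differentiableAt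
  have hg : ∀ᵐ x ∂volume.restrict (unitCube d),
      (f x : ℂ) - ∑ k, a k * planeWave (θ k) x = errorTower w a θ [] x := by
    filter_upwards [hf] with x hx
    rw [hx]
    simp [errorTower, planeSymbol]
  refine sobolevOn_unitCube_le hℓ hD fun L hL => ?_
  have hae := ae_pderivSeq_eq_zero_or (U := unitCube d) hdiff (fun i L x => by
      obtain ⟨D, hD, hDi⟩ := hT L x
      rw [hD.fderiv, hDi]) L [] _ ⟨_, (hdiff []).continuous.measurable, hg⟩
    (hg.mono fun x hx => Or.inr hx)
  filter_upwards [hae, ae_restrict_mem (isCompact_unitCube d).measurableSet] with x hx hxU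
  rcases hx with hx | hx
  · rw [hx, norm_zero]
    exact hD
  · rw [hx]
    exact h _ (by simpa using hL) x hxU

lemma mul_exp_neg_le_of_ceil_le {c₁ X δ β : ℝ} {d N : ℕ} (hd : 0 < d) (hc₁ : 0 < c₁)
    (hβ : 0 < β) (hX : 0 ≤ X) (hδ : 0 < δ)
    (hN : ⌈(c₁⁻¹ * Real.log (X / δ)) ^ ((d : ℝ) / β)⌉₊ ≤ N) :
    X * Real.exp (-(c₁ * (N : ℝ) ^ (β / d))) ≤ δ := by
  have hd' : (0 : ℝ) < d := by exact_mod_cast hd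
  rcases le_or_gt X δ with h | h
  · refine (mul_le_of_le_one_right hX (Real.exp_le_one_iff.2 ?_)).trans h
    rw [Left.neg_nonpos_iff]
    positivity
  · have h1 : 1 < X / δ := (one_lt_div hδ).2 h
    have hY : 0 < c₁⁻¹ * Real.log (X / δ) := mul_pos (inv_pos.2 hc₁) (Real.log_pos h1)
    have hY' : c₁⁻¹ * Real.log (X / δ) ≤ (N : ℝ) ^ (β / d) := by
      have := Real.rpow_le_rpow (by positivity) (Nat.ceil_le.1 hN) (by positivity : 0 ≤ β / d)
      rwa [← Real.rpow_mul hY.le, div_mul_div_cancel₀ hβ.ne', div_self hd'.ne',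
        Real.rpow_one] at this
    rw [inv_mul_le_iff₀ hc₁] at hY'
    rw [Real.exp_neg, ← div_eq_mul_inv, div_le_iff₀ (Real.exp_pos _), mul_comm δ,
      ← div_le_iff₀ hδ]
    exact (Real.log_le_iff_le_exp (by linarith)).1 hY'

/-- Approximation of the exponential spectral Barron space on the unit cube by
cosine networks in the Fréchet metric of Sobolev norms. -/
theorem stmt2 (d : ℕ) (hd : 0 < d) (c β : ℝ) (hc : 0 < c) (hβ0 : 0 < β) (hβ1 : β < 1) :
    ∃ C₀ : ℝ, 0 < C₀ ∧ ∃ cseq Cseq : ℕ → ℝ,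
      (∀ ℓ, 0 < cseq ℓ) ∧ (∀ ℓ, 0 < Cseq ℓ) ∧
      ∀ f : EuclideanSpace ℝ (Fin d) → ℝ,
        expBarronNorm β c (unitCube d) f ≠ ⊤ →
        ∀ Bf : ℝ, Bf = (expBarronNorm β c (unitCube d) f).toReal →
        ∀ ε : ℝ, 0 < ε → ε < 1 →
        ∀ ℓε : ℕ, ℓε = ⌈-Real.logb 2 ε⌉₊ + 1 →
        ∀ N : ℕ,
          max 1 ⌈((cseq ℓε)⁻¹ *
            Real.log ((2 : ℝ) ^ ℓε * Cseq ℓε * Bf)) ^ ((d : ℝ) / β)⌉₊ ≤ N →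
        (⨅ fN : cosineClass d N (C₀ * Bf), ∑' ℓ : ℕ,
          (2 : ℝ)⁻¹ ^ ℓ *
            (sobolevOn ℓ (unitCube d) (fun x => (f x : ℂ) - fN.1 x) /
              (1 + sobolevOn ℓ (unitCube d) (fun x => (f x : ℂ) - fN.1 x)))) ≤ ε := by
  obtain ⟨A₀, hA₀, c₁, hc₁, C, hC, happ⟩ := exists_network_error_le hd hc hβ0 hβ1
  have hV : 0 ≤ volume.real (unitCube d) := measureReal_nonneg
  set Q : ℕ → ℝ := fun ℓ => Real.sqrt ((ℓ + 1) ^ d * (volume.real (unitCube d) + 1)) with hQ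
  have hQ0 : ∀ ℓ, 0 < Q ℓ := fun ℓ => by positivity
  refine ⟨2 * A₀, by positivity, fun _ => c₁, fun ℓ => 4 * Q ℓ * C ℓ, fun _ => hc₁,
    fun ℓ => by have := hQ0 ℓ; have := hC ℓ; positivity, ?_⟩
  rintro f hf Bf rfl ε hε - n hn N hN
  set B := (expBarronNorm β c (unitCube d) f).toReal
  have hB : 0 ≤ B := ENNReal.toReal_nonneg
  obtain ⟨w, hw, hwi, hW, hfw⟩ := exists_weight_of_expBarronNorm hc.le hβ0.le
    (isCompact_unitCube d).measurableSet hf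
  obtain ⟨a, θ, ha, herr⟩ := happ w hw hwi N (le_of_max_le_left hN)
  set W := ∫ v : EuclideanSpace ℝ (Fin d), Real.exp (c * ‖v‖ ^ β) * ‖w v‖
  have hW0 : 0 ≤ W := integral_nonneg fun v => by positivity
  have hCn := hC n
  have hQn := hQ0 n
  have hsmall : Q n * (C n * W * Real.exp (-(c₁ * (N : ℝ) ^ (β / d)))) ≤ (2 : ℝ)⁻¹ ^ n / 2 := by
    have hlog : (2 : ℝ) ^ n * (4 * Q n * C n) * B = 4 * Q n * C n * B / (2 : ℝ)⁻¹ ^ n := by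
      rw [inv_pow, div_inv_eq_mul]
      ring
    have hNc := le_of_max_le_right hN
    rw [hlog] at hNc
    have := mul_exp_neg_le_of_ceil_le hd hc₁ hβ0 (by positivity) (by positivity) hNc
    calc _ ≤ Q n * (C n * (2 * B) * Real.exp (-(c₁ * (N : ℝ) ^ (β / d)))) := by gcongr
      _ = 4 * Q n * C n * B * Real.exp (-(c₁ * (N : ℝ) ^ (β / d))) / 2 := by ring
      _ ≤ _ := by gcongr
  let fN : cosineClass d N (2 * A₀ * B) := ⟨fun x => ∑ k, a k * planeWave (θ k) x, a, θ,
    ha.trans (by nlinarith), rfl⟩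
  have hbdd : BddBelow (Set.range fun fN : cosineClass d N (2 * A₀ * B) => ∑' ℓ : ℕ,
      (2 : ℝ)⁻¹ ^ ℓ * (sobolevOn ℓ (unitCube d) (fun x => (f x : ℂ) - fN.1 x) /
        (1 + sobolevOn ℓ (unitCube d) (fun x => (f x : ℂ) - fN.1 x)))) := by
    refine ⟨0, ?_⟩
    rintro _ ⟨g, rfl⟩
    refine tsum_nonneg fun ℓ => mul_nonneg (by positivity) (div_nonneg (Real.sqrt_nonneg _) ?_)
    exact add_nonneg zero_le_one (Real.sqrt_nonneg _)
  refine ciInf_le_of_le hbdd fN ?_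
  refine (tsum_geometric_mul_div_le (n := n) (fun ℓ => Real.sqrt_nonneg _)
    fun ℓ hℓ => ?_).trans ?_
  · exact (sobolevOn_sub_network_le hℓ hw (integrable_one_add_norm_pow_mul hc hβ0 hw hwi) hfw a θ
      (by positivity) fun L hL x hx => herr n L hL x hx).trans hsmall
  · rw [hn, pow_succ, ← Real.rpow_natCast, Real.inv_rpow zero_le_two, ← Real.rpow_neg zero_le_two]
    have hceil := Nat.le_ceil (-Real.logb 2 ε)
    calc _ = (2 : ℝ) ^ (-(⌈-Real.logb 2 ε⌉₊ : ℝ)) := by ring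
      _ ≤ 2 ^ Real.logb 2 ε := Real.rpow_le_rpow_of_exponent_le one_le_two (by linarith)
      _ = ε := Real.rpow_logb two_pos (by norm_num) hε

end
end

section
/- Let β ∈ (0,1), c > 0, and U = [0,2π] ⊂ ℝ. Then the L²(U)-unit ball is unbounded in B^{β,c}(U): for every R > 0 there exists f ∈ B^{β,c}(U) with ‖f‖_{L²(U)} = 1 and ‖f‖_{B^{β,c}(U)} > R. (Witnesses are given by f_n(x) = cos(nx)/√π, whose Barron norms satisfy ‖f_n‖_{B^{β,c}(U)} ≥ |U|^{−1/2} ( e^{⌊n^β cβ⌋ − 1} / ( √(2π) ⌊n^β cβ⌋ ) )^{1/β} → ∞ as n → ∞.) -/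
open MeasureTheory Real
open scoped ENNReal NNReal

noncomputable section

/-- One-dimensional Fourier transform with the convention
𝓕g(ξ) = (2π)^{−1/2} ∫ g(x) e^{−i x ξ} dx. -/
def fourier1 (g : ℝ → ℂ) (ξ : ℝ) : ℂ :=
  (((2 * Real.pi) ^ (-(1 : ℝ) / 2) : ℝ) : ℂ) *
    ∫ x : ℝ, g x * Complex.exp (-(Complex.I * (x : ℂ) * (ξ : ℂ)))

/-- The exponential spectral Barron norm on ℝ (d = 1), with values in `ℝ≥0∞`;
the infimum of the empty set is `⊤`. -/
def expBarronNorm1 (β c : ℝ) (U : Set ℝ) (f : ℝ → ℝ) : ℝ≥0∞ :=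
  sInf {y : ℝ≥0∞ | ∃ fe : ℝ → ℝ, Integrable fe ∧ Set.EqOn fe f U ∧
    y = ∫⁻ ξ, ENNReal.ofReal
      (Real.exp (c * |ξ| ^ β) * ‖fourier1 (fun x => (fe x : ℂ)) ξ‖)}

/-- `fourier1` is a rescaling of Mathlib's Fourier transform. -/
lemma fourier1_eq_fourier (g : ℝ → ℂ) (ξ : ℝ) :
    fourier1 g ξ =
      (((2 * π) ^ (-(1 : ℝ) / 2) : ℝ) : ℂ) * FourierTransform.fourier g (ξ / (2 * π)) := by
  have hpi : (π : ℂ) ≠ 0 := by exact_mod_cast pi_ne_zero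
  rw [fourier1, Real.fourier_real_eq_integral_exp_smul]
  congr 2
  ext x
  rw [smul_eq_mul, mul_comm]
  congr 2
  push_cast
  field_simp

/-- The values of an integrable function at its continuity points are controlled by the
`L¹` norm of its Fourier transform. -/
lemma ofReal_norm_le_lintegral_fourier1 {g : ℝ → ℂ} (hg : Integrable g) {v : ℝ}
    (hv : ContinuousAt g v) :
    ENNReal.ofReal ‖g v‖ ≤ ∫⁻ ξ, ENNReal.ofReal ‖fourier1 g ξ‖ := by
  have hcont : Continuous (FourierTransform.fourier g) :=
    VectorFourier.fourierIntegral_continuous Real.continuous_fourierChar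
      (innerSL ℝ).continuous₂ hg
  have h2pi : (0 : ℝ) < 2 * π := by positivity
  have hcont1 : Continuous (fourier1 g) := by
    rw [funext (fourier1_eq_fourier g)]
    fun_prop
  by_cases htop : ∫⁻ ξ, ENNReal.ofReal ‖fourier1 g ξ‖ = ⊤
  · rw [htop]
    exact le_top
  have hint : Integrable (fourier1 g) := by
    refine ⟨hcont1.aestronglyMeasurable, ?_⟩
    rw [hasFiniteIntegral_iff_norm]
    exact lt_top_iff_ne_top.mpr htop
  have hC : 0 < (2 * π) ^ (-(1 : ℝ) / 2) := by positivity
  have hintF : Integrable (FourierTransform.fourier g) := by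
    rw [← integrable_comp_div_iff _ h2pi.ne']
    refine (hint.const_mul ((((2 * π) ^ (-(1 : ℝ) / 2) : ℝ) : ℂ)⁻¹)).congr (ae_of_all _ fun ξ => ?_)
    have : (((2 * π) ^ (-(1 : ℝ) / 2) : ℝ) : ℂ) ≠ 0 := by exact_mod_cast hC.ne'
    simp only [fourier1_eq_fourier]
    rw [inv_mul_cancel_left₀ this]
  rw [← ofReal_integral_eq_lintegral_ofReal hint.norm (ae_of_all _ fun _ => norm_nonneg _)]
  apply ENNReal.ofReal_le_ofReal
  rw [← hg.fourierInv_fourier_eq hintF hv, Real.fourierInv_eq]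
  refine (norm_integral_le_integral_norm _).trans ?_
  simp only [Circle.norm_smul]
  have hscale : ∫ ξ, ‖fourier1 g ξ‖ = (2 * π) ^ (-(1 : ℝ) / 2) * (2 * π *
      ∫ w, ‖FourierTransform.fourier g w‖) := by
    simp only [fourier1_eq_fourier, norm_mul, Complex.norm_real, Real.norm_of_nonneg hC.le]
    rw [integral_const_mul,
      Measure.integral_comp_div (fun w => ‖FourierTransform.fourier g w‖),
      abs_of_pos h2pi, smul_eq_mul]
  rw [hscale, ← mul_assoc]
  refine le_mul_of_one_le_left (integral_nonneg fun _ => norm_nonneg _) ?_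
  rw [← rpow_add_one h2pi.ne']
  exact one_le_rpow (by nlinarith [pi_gt_three]) (by norm_num)

/-- Pointwise values in the interior are bounded by the exponential Barron norm. -/
lemma ofReal_abs_le_expBarronNorm1 {β c : ℝ} (hc : 0 ≤ c) {U : Set ℝ} {f : ℝ → ℝ} {v : ℝ}
    (hU : U ∈ nhds v) (hf : ContinuousAt f v) :
    ENNReal.ofReal |f v| ≤ expBarronNorm1 β c U f := by
  refine le_sInf ?_
  rintro y ⟨fe, hfe, heq, rfl⟩
  have hev : fe =ᶠ[nhds v] f := Filter.eventually_of_mem hU heq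
  have hcont : ContinuousAt (fun x => (fe x : ℂ)) v :=
    Complex.continuous_ofReal.continuousAt.comp (hf.congr hev.symm)
  have h := ofReal_norm_le_lintegral_fourier1 (g := fun x => (fe x : ℂ)) hfe.ofReal hcont
  rw [Complex.norm_real, hev.eq_of_nhds, Real.norm_eq_abs] at h
  refine h.trans (lintegral_mono fun ξ => ENNReal.ofReal_le_ofReal ?_)
  refine le_mul_of_one_le_left (norm_nonneg _) (one_le_exp ?_)
  positivity

lemma integrable_gaussian_sub {b : ℝ} (hb : 0 < b) (a : ℝ) :
    Integrable fun x : ℝ => exp (-b * (x - a) ^ 2) :=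
  (integrable_exp_neg_mul_sq hb).comp_sub_right a

lemma norm_fourier1_gaussian {b : ℝ} (hb : 0 < b) (A a : ℝ) :
    ∃ K : ℝ, 0 ≤ K ∧ ∀ ξ : ℝ,
      ‖fourier1 (fun x => ((A * exp (-b * (x - a) ^ 2) : ℝ) : ℂ)) ξ‖ =
        K * exp (-ξ ^ 2 / (4 * b)) := by
  refine ⟨‖(((2 * π) ^ (-(1 : ℝ) / 2) : ℝ) : ℂ)‖ * (‖(A : ℂ)‖ *
    ‖((π : ℂ) / -(-(b : ℂ))) ^ (1 / 2 : ℂ)‖), by positivity, fun ξ => ?_⟩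
  have hb0 : (b : ℂ) ≠ 0 := by exact_mod_cast hb.ne'
  have key : ∀ x : ℝ, ((A * exp (-b * (x - a) ^ 2) : ℝ) : ℂ) *
      Complex.exp (-(Complex.I * (x : ℂ) * (ξ : ℂ))) =
      A * Complex.exp (-(b : ℂ) * x ^ 2 + (2 * b * a - Complex.I * ξ) * x + -(b * a ^ 2)) := by
    intro x
    push_cast
    rw [mul_assoc, ← Complex.exp_add]
    congr 2
    ring
  have hexp : -(b * a ^ 2 : ℂ) - (2 * b * a - Complex.I * ξ) ^ 2 / (4 * -(b : ℂ)) =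
      ((-ξ ^ 2 / (4 * b) : ℝ) : ℂ) + ((-(a * ξ) : ℝ) : ℂ) * Complex.I := by
    push_cast
    field_simp
    ring_nf
    rw [Complex.I_sq]
    ring
  simp only [fourier1, key]
  rw [integral_const_mul, integral_cexp_quadratic (by simpa using hb), hexp, Complex.exp_add,
    norm_mul, norm_mul, norm_mul, norm_mul, Complex.norm_exp_ofReal_mul_I,
    Complex.norm_exp_ofReal, mul_one]
  ring

/-- Gaussians have finite exponential Barron norm for exponents at most one. -/
lemma expBarronNorm1_gaussian_ne_top {β c b : ℝ} (hβ0 : 0 ≤ β) (hβ1 : β ≤ 1) (hc : 0 ≤ c)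
    (hb : 0 < b) (A a : ℝ) (U : Set ℝ) :
    expBarronNorm1 β c U (fun x => A * exp (-b * (x - a) ^ 2)) ≠ ⊤ := by
  obtain ⟨K, hK0, hK⟩ := norm_fourier1_gaussian hb A a
  refine ne_top_of_le_ne_top ?_
    (sInf_le ⟨_, (integrable_gaussian_sub hb a).const_mul A, Set.eqOn_refl _ _, rfl⟩)
  have hdom : Integrable fun ξ : ℝ =>
      K * exp (c + 2 * b * c ^ 2) * exp (-(1 / (8 * b)) * ξ ^ 2) :=
    (integrable_exp_neg_mul_sq (by positivity)).const_mul _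
  refine ne_top_of_le_ne_top hdom.lintegral_lt_top.ne
    (lintegral_mono fun ξ => ENNReal.ofReal_le_ofReal ?_)
  rw [hK, mul_left_comm, mul_assoc, ← exp_add, ← exp_add]
  refine mul_le_mul_of_nonneg_left (exp_le_exp.mpr ?_) hK0
  have hpow : |ξ| ^ β ≤ 1 + |ξ| := by
    calc |ξ| ^ β ≤ (1 + |ξ|) ^ β := rpow_le_rpow (abs_nonneg _) (by linarith) hβ0
      _ ≤ (1 + |ξ|) ^ (1 : ℝ) := rpow_le_rpow_of_exponent_le (by linarith [abs_nonneg ξ]) hβ1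
      _ = 1 + |ξ| := rpow_one _
  have hsq : c * |ξ| ≤ ξ ^ 2 / (8 * b) + 2 * b * c ^ 2 := by
    have h : ξ ^ 2 / (8 * b) + 2 * b * c ^ 2 - c * |ξ| = (|ξ| - 4 * b * c) ^ 2 / (8 * b) := by
      rw [← sq_abs ξ]
      field_simp
      ring
    have : 0 ≤ (|ξ| - 4 * b * c) ^ 2 / (8 * b) := by positivity
    linarith
  have hsplit : -ξ ^ 2 / (4 * b) = -(ξ ^ 2 / (8 * b)) - ξ ^ 2 / (8 * b) := by
    field_simp
    ring
  have h1 : -(1 / (8 * b)) * ξ ^ 2 = -(ξ ^ 2 / (8 * b)) := by ring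
  rw [hsplit, h1]
  nlinarith [mul_le_mul_of_nonneg_left hpow hc]

/-- Concentrated Gaussians have small mass on any set. -/
lemma setIntegral_gaussian_le {b : ℝ} (hb : 0 < b) (a : ℝ) (U : Set ℝ) :
    ∫ x in U, exp (-b * (x - a) ^ 2) ≤ √(π / b) := by
  rw [← integral_gaussian b, ← integral_sub_right_eq_self (fun x => exp (-b * x ^ 2)) a]
  exact setIntegral_le_integral (integrable_gaussian_sub hb a)
    (ae_of_all _ fun _ => (exp_pos _).le)

/-- The L²([0,2π])-unit ball is unbounded in B^{β,c}([0,2π]) for β ∈ (0,1). -/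
theorem stmt15 (β c : ℝ) (hβ0 : 0 < β) (hβ1 : β < 1) (hc : 0 < c) :
    ∀ R : ℝ, 0 < R →
      ∃ f : ℝ → ℝ,
        expBarronNorm1 β c (Set.Icc 0 (2 * Real.pi)) f ≠ ⊤ ∧
        Real.sqrt (∫ x in Set.Icc 0 (2 * Real.pi), f x ^ 2) = 1 ∧
        R < (expBarronNorm1 β c (Set.Icc 0 (2 * Real.pi)) f).toReal := by
  intro R hR
  obtain ⟨b, hb, hbR⟩ : ∃ b : ℝ, 0 < b ∧ R ^ 2 * √(π / (2 * b)) < 1 := by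
    refine ⟨π * R ^ 4, by positivity, ?_⟩
    have h : π / (2 * (π * R ^ 4)) = (1 / 2) * (1 / R ^ 2) ^ 2 := by
      field_simp
    rw [h, sqrt_mul (by norm_num), sqrt_sq (by positivity)]
    have : √(1 / 2 : ℝ) < 1 := by
      rw [sqrt_lt' one_pos]
      norm_num
    calc R ^ 2 * (√(1 / 2) * (1 / R ^ 2)) = √(1 / 2) := by field_simp
      _ < 1 := this
  set I : ℝ := ∫ x in Set.Icc 0 (2 * π), exp (-(2 * b) * (x - π) ^ 2) with hI
  have hIpos : 0 < I := by
    rw [hI, setIntegral_pos_iff_support_of_nonneg_ae (ae_of_all _ fun _ => (exp_pos _).le)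
      (integrable_gaussian_sub (by positivity) π).integrableOn]
    have : Function.support (fun x : ℝ => exp (-(2 * b) * (x - π) ^ 2)) = Set.univ :=
      Set.eq_univ_of_forall fun x => (exp_pos _).ne'
    rw [this, Set.univ_inter, Real.volume_Icc]
    simpa using pi_pos
  have hIle : I ≤ √(π / (2 * b)) := setIntegral_gaussian_le (by positivity) _ _
  have hlt : R < (√I)⁻¹ := by
    rw [lt_inv_comm₀ hR (sqrt_pos.mpr hIpos), sqrt_lt' (by positivity), inv_pow,
      ← one_div, lt_div_iff₀ (by positivity)]
    nlinarith [sq_nonneg R]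
  have hfin := expBarronNorm1_gaussian_ne_top hβ0.le hβ1.le hc.le hb (√I)⁻¹ π
    (Set.Icc 0 (2 * π))
  refine ⟨fun x => (√I)⁻¹ * exp (-b * (x - π) ^ 2), hfin, ?_, ?_⟩
  · have hsq : ∀ x : ℝ, ((√I)⁻¹ * exp (-b * (x - π) ^ 2)) ^ 2 =
        I⁻¹ * exp (-(2 * b) * (x - π) ^ 2) := by
      intro x
      rw [mul_pow, inv_pow, sq_sqrt hIpos.le, ← exp_nat_mul]
      congr 2
      push_cast
      ring
    simp only [hsq]
    rw [integral_const_mul, ← hI, inv_mul_cancel₀ hIpos.ne', sqrt_one]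
  · have hle := ofReal_abs_le_expBarronNorm1 (β := β) hc.le
      (f := fun x => (√I)⁻¹ * exp (-b * (x - π) ^ 2))
      (Icc_mem_nhds pi_pos (by linarith [pi_pos] : π < 2 * π)) (by fun_prop)
    rw [ENNReal.ofReal_le_iff_le_toReal hfin] at hle
    refine lt_of_lt_of_le ?_ hle
    simpa [abs_of_pos (sqrt_pos.mpr hIpos)] using hlt

end
end
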